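/- arXiv:2404.12844 — 6 statements merged into one kernel-verified Lean document; each statement's English description precedes it below -/
import Mathlib

section
/- Let ω = ζ₇ + ζ₇⁻¹ = 2cos(2π/7), a root of the irreducible polynomial T³ + T² − 2T − 1, and let K₄₉ = ℚ(ω); the ring of integers of K₄₉ is ℤ[ω]. Let n and m be positive integers with n ≡ 28 (mod 32), m ≡ 5 (mod 8), and 13m < 4n < 16m. Then n − m·ω² is totally positive and is a sum of three squares of elements of ℤ[ω]; in particular, there exist w, x, y, z ∈ ℤ[ω] with n = w² + x² + y² + m·z². -/
/-- The ring of integers of the cubic field of discriminant `49`, in coordinates with respect to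
the normal basis `e₁ = ζ₇ + ζ₇⁻¹`, `e₂ = ζ₇² + ζ₇⁻²`, `e₃ = ζ₇⁴ + ζ₇⁻⁴`. -/
@[ext] structure CubicInt where
  x : ℤ
  y : ℤ
  z : ℤ

namespace CubicInt

instance : Zero CubicInt := ⟨⟨0, 0, 0⟩⟩
instance : One CubicInt := ⟨⟨-1, -1, -1⟩⟩
instance : Add CubicInt := ⟨fun a b => ⟨a.x + b.x, a.y + b.y, a.z + b.z⟩⟩
instance : Neg CubicInt := ⟨fun a => ⟨-a.x, -a.y, -a.z⟩⟩
instance : Sub CubicInt := ⟨fun a b => ⟨a.x - b.x, a.y - b.y, a.z - b.z⟩⟩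
instance : Mul CubicInt := ⟨fun a b =>
  ⟨-2 * a.x * b.x - 2 * a.y * b.y - a.z * b.z + (a.x * b.y + a.y * b.x)
      + (a.y * b.z + a.z * b.y),
    -a.x * b.x - 2 * a.y * b.y - 2 * a.z * b.z + (a.y * b.z + a.z * b.y)
      + (a.x * b.z + a.z * b.x),
    -2 * a.x * b.x - a.y * b.y - 2 * a.z * b.z + (a.x * b.y + a.y * b.x)
      + (a.x * b.z + a.z * b.x)⟩⟩
instance : NatCast CubicInt := ⟨fun n => ⟨-n, -n, -n⟩⟩
instance : IntCast CubicInt := ⟨fun n => ⟨-n, -n, -n⟩⟩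

@[simp] lemma zero_x : (0 : CubicInt).x = 0 := rfl
@[simp] lemma zero_y : (0 : CubicInt).y = 0 := rfl
@[simp] lemma zero_z : (0 : CubicInt).z = 0 := rfl
@[simp] lemma one_x : (1 : CubicInt).x = -1 := rfl
@[simp] lemma one_y : (1 : CubicInt).y = -1 := rfl
@[simp] lemma one_z : (1 : CubicInt).z = -1 := rfl
@[simp] lemma add_x (a b : CubicInt) : (a + b).x = a.x + b.x := rfl
@[simp] lemma add_y (a b : CubicInt) : (a + b).y = a.y + b.y := rfl
@[simp] lemma add_z (a b : CubicInt) : (a + b).z = a.z + b.z := rfl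
@[simp] lemma neg_x (a : CubicInt) : (-a).x = -a.x := rfl
@[simp] lemma neg_y (a : CubicInt) : (-a).y = -a.y := rfl
@[simp] lemma neg_z (a : CubicInt) : (-a).z = -a.z := rfl
@[simp] lemma sub_x (a b : CubicInt) : (a - b).x = a.x - b.x := rfl
@[simp] lemma sub_y (a b : CubicInt) : (a - b).y = a.y - b.y := rfl
@[simp] lemma sub_z (a b : CubicInt) : (a - b).z = a.z - b.z := rfl
@[simp] lemma mul_x (a b : CubicInt) : (a * b).x = -2 * a.x * b.x - 2 * a.y * b.y - a.z * b.z
    + (a.x * b.y + a.y * b.x) + (a.y * b.z + a.z * b.y) := rfl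
@[simp] lemma mul_y (a b : CubicInt) : (a * b).y = -a.x * b.x - 2 * a.y * b.y - 2 * a.z * b.z
    + (a.y * b.z + a.z * b.y) + (a.x * b.z + a.z * b.x) := rfl
@[simp] lemma mul_z (a b : CubicInt) : (a * b).z = -2 * a.x * b.x - a.y * b.y - 2 * a.z * b.z
    + (a.x * b.y + a.y * b.x) + (a.x * b.z + a.z * b.x) := rfl

@[simp] lemma intCast_x (n : ℤ) : (n : CubicInt).x = -n := rfl
@[simp] lemma intCast_y (n : ℤ) : (n : CubicInt).y = -n := rfl
@[simp] lemma intCast_z (n : ℤ) : (n : CubicInt).z = -n := rfl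
@[simp] lemma natCast_x (n : ℕ) : (n : CubicInt).x = -n := rfl
@[simp] lemma natCast_y (n : ℕ) : (n : CubicInt).y = -n := rfl
@[simp] lemma natCast_z (n : ℕ) : (n : CubicInt).z = -n := rfl

instance : CommRing CubicInt where
  add_assoc a b c := by ext <;> simp <;> ring
  zero_add a := by ext <;> simp
  add_zero a := by ext <;> simp
  add_comm a b := by ext <;> simp <;> ring
  mul_assoc a b c := by ext <;> simp <;> ring
  one_mul a := by ext <;> simp <;> ring
  mul_one a := by ext <;> simp <;> ring
  mul_comm a b := by ext <;> simp <;> ring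
  left_distrib a b c := by ext <;> simp <;> ring
  right_distrib a b c := by ext <;> simp <;> ring
  zero_mul a := by ext <;> simp
  mul_zero a := by ext <;> simp
  neg_add_cancel a := by ext <;> simp
  sub_eq_add_neg a b := by ext <;> simp <;> ring
  natCast_zero := by ext <;> simp
  natCast_succ n := by ext <;> simp <;> ring
  intCast_ofNat n := by ext <;> simp
  intCast_negSucc n := by ext <;> simp
  nsmul := nsmulRec
  zsmul := zsmulRec

@[simp] lemma ofNat_x (n : ℕ) [n.AtLeastTwo] : (ofNat(n) : CubicInt).x = -n := rfl
@[simp] lemma ofNat_y (n : ℕ) [n.AtLeastTwo] : (ofNat(n) : CubicInt).y = -n := rfl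
@[simp] lemma ofNat_z (n : ℕ) [n.AtLeastTwo] : (ofNat(n) : CubicInt).z = -n := rfl

lemma intCast_dvd {n : ℤ} {a : CubicInt} (hx : n ∣ a.x) (hy : n ∣ a.y) (hz : n ∣ a.z) :
    (n : CubicInt) ∣ a := by
  obtain ⟨u, hu⟩ := hx
  obtain ⟨v, hv⟩ := hy
  obtain ⟨w, hw⟩ := hz
  refine ⟨⟨u, v, w⟩, ?_⟩
  ext <;> simp [hu, hv, hw] <;> ring

/-- The generator `e₁ ↦ e₂ ↦ e₃ ↦ e₁` of the Galois group. -/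
def conj : CubicInt →+* CubicInt where
  toFun a := ⟨a.z, a.x, a.y⟩
  map_one' := rfl
  map_mul' a b := by ext <;> simp <;> ring
  map_zero' := rfl
  map_add' _ _ := rfl

@[simp] lemma conj_x (a : CubicInt) : (conj a).x = a.z := rfl
@[simp] lemma conj_y (a : CubicInt) : (conj a).y = a.x := rfl
@[simp] lemma conj_z (a : CubicInt) : (conj a).z = a.y := rfl

/-- The product of the two nontrivial conjugates. -/
def adj (a : CubicInt) : CubicInt := conj a * conj (conj a)

def norm (a : CubicInt) : ℤ := -(a * adj a).x

def trace (a : CubicInt) : ℤ := -(a.x + a.y + a.z)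

lemma conj_conj_conj (a : CubicInt) : conj (conj (conj a)) = a := rfl

lemma adj_eq (a : CubicInt) : adj a =
    ⟨a.z ^ 2 + a.x ^ 2 - a.z * a.y - 2 * a.x * a.z,
      a.x ^ 2 + a.y ^ 2 - a.x * a.z - 2 * a.x * a.y,
      a.y ^ 2 + a.z ^ 2 - a.x * a.y - 2 * a.z * a.y⟩ := by
  ext <;> simp only [adj, mul_x, mul_y, mul_z, conj_x, conj_y, conj_z] <;> ring

lemma mul_adj (a : CubicInt) : a * adj a = (norm a : CubicInt) := by
  ext <;> simp only [norm, adj_eq, mul_x, mul_y, mul_z, intCast_x, intCast_y, intCast_z] <;> ring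

lemma trace_cast (a : CubicInt) : (trace a : CubicInt) = a + conj a + conj (conj a) := by
  ext <;> simp [trace] <;> ring

lemma intCast_inj {m n : ℤ} (h : (m : CubicInt) = n) : m = n := by
  have := congrArg CubicInt.x h
  simpa using this

lemma norm_mul (a b : CubicInt) : norm (a * b) = norm a * norm b := by
  apply intCast_inj
  rw [Int.cast_mul, ← mul_adj, ← mul_adj, ← mul_adj]
  simp only [adj, map_mul]
  ring

lemma norm_conj (a : CubicInt) : norm (conj a) = norm a := by
  apply intCast_inj
  rw [← mul_adj, ← mul_adj]
  simp only [adj, conj_conj_conj]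
  ring

lemma norm_adj (a : CubicInt) : norm (adj a) = norm a ^ 2 := by
  rw [adj, norm_mul, norm_conj, norm_conj, norm_conj]; ring

lemma norm_one : norm 1 = 1 := rfl

lemma norm_pow (a : CubicInt) (k : ℕ) : norm (a ^ k) = norm a ^ k := by
  induction k with
  | zero => simp [norm_one]
  | succ k ih => rw [pow_succ, norm_mul, ih, pow_succ]

lemma norm_unit_sq {e e' : CubicInt} (h : e * e' = 1) : norm e ^ 2 = 1 := by
  have h1 : norm e * norm e' = 1 := by rw [← norm_mul, h, norm_one]
  rcases Int.isUnit_iff.1 (IsUnit.of_mul_eq_one _ h1) with h2 | h2 <;> rw [h2] <;> norm_num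

/-- Positivity at the three real places, `φ` being one of them. -/
def TotPos (φ : CubicInt →+* ℝ) (a : CubicInt) : Prop :=
  0 < φ a ∧ 0 < φ (conj a) ∧ 0 < φ (conj (conj a))

lemma map_norm (φ : CubicInt →+* ℝ) (a : CubicInt) :
    (norm a : ℝ) = φ a * φ (conj a) * φ (conj (conj a)) := by
  rw [← map_intCast φ, ← mul_adj, adj, map_mul, map_mul, mul_assoc]

lemma map_trace (φ : CubicInt →+* ℝ) (a : CubicInt) :
    (trace a : ℝ) = φ a + φ (conj a) + φ (conj (conj a)) := by
  rw [← map_intCast φ, trace_cast, map_add, map_add]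

namespace TotPos

variable {φ : CubicInt →+* ℝ} {a b : CubicInt}

lemma norm_pos (ha : TotPos φ a) : 0 < norm a := by
  have : (0 : ℝ) < norm a := by
    rw [map_norm φ]; exact mul_pos (mul_pos ha.1 ha.2.1) ha.2.2
  exact_mod_cast this

lemma trace_pos (ha : TotPos φ a) : 0 < trace a := by
  have : (0 : ℝ) < trace a := by
    rw [map_trace φ]; linarith [ha.1, ha.2.1, ha.2.2]
  exact_mod_cast this

lemma am_gm (ha : TotPos φ a) : 27 * norm a ≤ trace a ^ 3 := by
  have : (27 : ℝ) * norm a ≤ trace a ^ 3 := by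
    rw [map_norm φ, map_trace φ]
    obtain ⟨h1, h2, h3⟩ := ha
    generalize φ a = u at *
    generalize φ (conj a) = v at *
    generalize φ (conj (conj a)) = w at *
    nlinarith [mul_nonneg h1.le (sq_nonneg (v - w)), mul_nonneg h2.le (sq_nonneg (u - w)),
      mul_nonneg h3.le (sq_nonneg (u - v)),
      mul_nonneg (add_nonneg (add_nonneg h1.le h2.le) h3.le) (sq_nonneg (u - v)),
      mul_nonneg (add_nonneg (add_nonneg h1.le h2.le) h3.le) (sq_nonneg (u - w)),
      mul_nonneg (add_nonneg (add_nonneg h1.le h2.le) h3.le) (sq_nonneg (v - w))]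
  exact_mod_cast this

lemma mul (ha : TotPos φ a) (hb : TotPos φ b) : TotPos φ (a * b) := by
  simp only [TotPos, map_mul] at *
  exact ⟨mul_pos ha.1 hb.1, mul_pos ha.2.1 hb.2.1, mul_pos ha.2.2 hb.2.2⟩

lemma conj (ha : TotPos φ a) : TotPos φ (conj a) :=
  ⟨ha.2.1, ha.2.2, by rw [conj_conj_conj]; exact ha.1⟩

lemma adj (ha : TotPos φ a) : TotPos φ (adj a) := ha.conj.mul ha.conj.conj

lemma add_sq (ha : TotPos φ a) (b : CubicInt) : TotPos φ (b ^ 2 + a) := by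
  obtain ⟨h1, h2, h3⟩ := ha
  simp only [TotPos, map_add, map_pow]
  exact ⟨by positivity, by positivity, by positivity⟩

lemma intCast {n : ℤ} (hn : 0 < n) : TotPos φ n := by
  simp only [TotPos, map_intCast]
  have : (0 : ℝ) < n := by exact_mod_cast hn
  exact ⟨this, this, this⟩

lemma mul_unit_sq (ha : TotPos φ a) {e e' : CubicInt} (h : e * e' = 1) :
    TotPos φ (a * e ^ 2) := by
  have key : ∀ ψ : CubicInt →+* ℝ, 0 < ψ a → 0 < ψ (a * e ^ 2) := by
    intro ψ hψ
    have h1 : ψ e ≠ 0 := fun h0 => by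
      have := congrArg ψ h
      rw [map_mul, h0, zero_mul, map_one] at this
      exact zero_ne_one this
    rw [map_mul, map_pow]
    positivity
  exact ⟨key φ ha.1, key (φ.comp CubicInt.conj) ha.2.1,
    key ((φ.comp CubicInt.conj).comp CubicInt.conj) ha.2.2⟩

end TotPos

/-- The value at `(p, r)` of a binary form of determinant `f` with first coefficient `a`, when
`(p, r)` is unimodular. -/
lemma TotPos.binary {φ : CubicInt →+* ℝ} {a b d p q r s : CubicInt} (ha : TotPos φ a)
    (hf : TotPos φ (a * d - b ^ 2)) (h : p * s - q * r = 1) :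
    TotPos φ (p ^ 2 * a + 2 * p * r * b + r ^ 2 * d) := by
  have key : ∀ ψ : CubicInt →+* ℝ, 0 < ψ a → 0 < ψ (a * d - b ^ 2) →
      0 < ψ (p ^ 2 * a + 2 * p * r * b + r ^ 2 * d) := by
    intro ψ h1 h2
    have h3 := congrArg ψ h
    simp only [map_add, map_sub, map_mul, map_pow, map_one, map_ofNat] at *
    have h4 : 0 < ψ a * (ψ p ^ 2 * ψ a + 2 * ψ p * ψ r * ψ b + ψ r ^ 2 * ψ d) := by
      have h5 : ψ a * (ψ p ^ 2 * ψ a + 2 * ψ p * ψ r * ψ b + ψ r ^ 2 * ψ d)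
          = (ψ p * ψ a + ψ r * ψ b) ^ 2 + ψ r ^ 2 * (ψ a * ψ d - ψ b ^ 2) := by ring
      rw [h5]
      by_cases hr : ψ r = 0
      · have hp : ψ p ≠ 0 := by
          intro hp; rw [hr, hp] at h3; simp at h3
        rw [hr]
        have := h1.ne'
        simp only [zero_mul, add_zero]
        positivity
      · positivity
    exact pos_of_mul_pos_right h4 h1.le
  exact ⟨key φ ha.1 hf.1, key (φ.comp CubicInt.conj) ha.2.1 hf.2.1,
    key ((φ.comp CubicInt.conj).comp CubicInt.conj) ha.2.2 hf.2.2⟩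

/-- The trace of `a` does not decrease when `a` is multiplied by the square of a conjugate of
`e₁` or of its inverse. -/
def Reduced (a : CubicInt) : Prop :=
  (3 * a.x - 4 * a.y + 3 * a.z ≤ 0 ∧ 3 * a.x + 3 * a.y - 4 * a.z ≤ 0 ∧
    -4 * a.x + 3 * a.y + 3 * a.z ≤ 0) ∧
  (a.x + 8 * a.y - 6 * a.z ≤ 0 ∧ -6 * a.x + a.y + 8 * a.z ≤ 0 ∧ 8 * a.x - 6 * a.y + a.z ≤ 0)

lemma norm_eq (a : CubicInt) : norm a = a.x ^ 3 + a.y ^ 3 + a.z ^ 3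
    + 3 * (a.x ^ 2 * a.y + a.y ^ 2 * a.z + a.z ^ 2 * a.x)
    - 4 * (a.x * a.y ^ 2 + a.y * a.z ^ 2 + a.z * a.x ^ 2) - a.x * a.y * a.z := by
  simp only [norm, adj_eq, mul_x]; ring

private lemma cubic_le_left {x y z : ℤ} (h1 : 0 ≤ 8 * x - 6 * y + z) (h2 : 0 ≤ z - x)
    (h3 : 0 ≤ -x + 3 * y - 2 * z) : (x + y + z) ^ 3 ≤ 56 * norm ⟨-x, -y, -z⟩ := by
  simp only [norm_eq]
  linarith [pow_nonneg h1 3, pow_nonneg h2 3, pow_nonneg h3 3, mul_nonneg (pow_nonneg h1 2) h2,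
    mul_nonneg (pow_nonneg h1 2) h3, mul_nonneg (pow_nonneg h2 2) h1,
    mul_nonneg (pow_nonneg h2 2) h3, mul_nonneg (pow_nonneg h3 2) h1,
    mul_nonneg (pow_nonneg h3 2) h2, mul_nonneg (mul_nonneg h1 h2) h3]

private lemma cubic_le_right {x y z : ℤ} (h1 : 0 ≤ 3 * x - 4 * y + 3 * z) (h2 : 0 ≤ x - z)
    (h3 : 0 ≤ -3 * x + 2 * y + z) : (x + y + z) ^ 3 ≤ 56 * norm ⟨-x, -y, -z⟩ := by
  simp only [norm_eq]
  linarith [pow_nonneg h1 3, pow_nonneg h2 3, pow_nonneg h3 3, mul_nonneg (pow_nonneg h1 2) h2,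
    mul_nonneg (pow_nonneg h1 2) h3, mul_nonneg (pow_nonneg h2 2) h1,
    mul_nonneg (pow_nonneg h2 2) h3, mul_nonneg (pow_nonneg h3 2) h1,
    mul_nonneg (pow_nonneg h3 2) h2, mul_nonneg (mul_nonneg h1 h2) h3]

lemma trace_cube_le {a : CubicInt} (h : Reduced a) : trace a ^ 3 ≤ 56 * norm a := by
  obtain ⟨⟨h1, h2, h3⟩, h4, h5, h6⟩ := h
  obtain ⟨x, y, z⟩ := a
  simp only at h1 h2 h3 h4 h5 h6
  have h : (x ≥ z ∧ 0 ≥ -x + 3 * y - 2 * z) ∨ (z ≥ x ∧ 0 ≥ -3 * x + 2 * y + z) ∨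
      (y ≥ x ∧ 0 ≥ -y + 3 * z - 2 * x) ∨ (x ≥ y ∧ 0 ≥ -3 * y + 2 * z + x) ∨
      (z ≥ y ∧ 0 ≥ -z + 3 * x - 2 * y) ∨ (y ≥ z ∧ 0 ≥ -3 * z + 2 * x + y) := by omega
  rcases h with ⟨h7, h8⟩ | ⟨h7, h8⟩ | ⟨h7, h8⟩ | ⟨h7, h8⟩ | ⟨h7, h8⟩ | ⟨h7, h8⟩
  · have := @cubic_le_left (-x) (-y) (-z) (by linarith) (by linarith) (by linarith)
    simp only [trace, norm_eq] at *; linarith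
  · have := @cubic_le_right (-x) (-y) (-z) (by linarith) (by linarith) (by linarith)
    simp only [trace, norm_eq] at *; linarith
  · have := @cubic_le_left (-y) (-z) (-x) (by linarith) (by linarith) (by linarith)
    simp only [trace, norm_eq] at *; linarith
  · have := @cubic_le_right (-y) (-z) (-x) (by linarith) (by linarith) (by linarith)
    simp only [trace, norm_eq] at *; linarith
  · have := @cubic_le_left (-z) (-x) (-y) (by linarith) (by linarith) (by linarith)
    simp only [trace, norm_eq] at *; linarith
  · have := @cubic_le_right (-z) (-x) (-y) (by linarith) (by linarith) (by linarith)
    simp only [trace, norm_eq] at *; linarith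

private lemma exists_close_of_le {n p q r : ℤ} (hn : 0 < n) (hr : 0 ≤ r) (hrq : r ≤ q)
    (hqp : q ≤ p) (hp : p ≤ n) : ∃ i j k : ℤ,
    28 * (7 * ((p - n * i) ^ 2 + (q - n * j) ^ 2 + (r - n * k) ^ 2)
      - 2 * (p - n * i + (q - n * j) + (r - n * k)) ^ 2) ≤ 53 * n ^ 2 := by
  by_contra! H
  have h0 := H 0 0 0
  have h1 := H 1 0 0
  have h2 := H 1 1 0
  have h3 := H 1 1 1
  have key : 0 ≤ n * (7 * ((14 * p - 11 * n) ^ 2 + (14 * q - 7 * n) ^ 2 + (14 * r - 3 * n) ^ 2)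
      - 2 * (14 * p - 11 * n + (14 * q - 7 * n) + (14 * r - 3 * n)) ^ 2) := by
    apply mul_nonneg hn.le
    generalize 14 * p - 11 * n = u
    generalize 14 * q - 7 * n = v
    generalize 14 * r - 3 * n = w
    nlinarith [sq_nonneg (u - v), sq_nonneg (u - w), sq_nonneg (v - w), sq_nonneg u, sq_nonneg v,
      sq_nonneg w]
  rcases hp.lt_or_eq with hp' | rfl
  · nlinarith [mul_lt_mul_of_pos_left h0 (sub_pos.2 hp'),
      mul_le_mul_of_nonneg_left h1.le (sub_nonneg.2 hqp),
      mul_le_mul_of_nonneg_left h2.le (sub_nonneg.2 hrq), mul_le_mul_of_nonneg_left h3.le hr]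
  rcases hqp.lt_or_eq with hp' | rfl
  · nlinarith [mul_lt_mul_of_pos_left h1 (sub_pos.2 hp'),
      mul_le_mul_of_nonneg_left h2.le (sub_nonneg.2 hrq), mul_le_mul_of_nonneg_left h3.le hr]
  rcases hrq.lt_or_eq with hp' | rfl
  · nlinarith [mul_lt_mul_of_pos_left h2 (sub_pos.2 hp'), mul_le_mul_of_nonneg_left h3.le hr]
  · nlinarith [mul_lt_mul_of_pos_left h3 hn]

lemma trace_sq (a : CubicInt) :
    trace (a ^ 2) = 7 * (a.x ^ 2 + a.y ^ 2 + a.z ^ 2) - 2 * (a.x + a.y + a.z) ^ 2 := by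
  simp only [trace, sq a, mul_x, mul_y, mul_z]; ring

/-- A bound for the covering radius of the trace form. -/
lemma exists_trace_sq_sub_le (v : CubicInt) {n : ℤ} (hn : 0 < n) :
    ∃ w : CubicInt, 28 * trace ((v - n * w) ^ 2) ≤ 53 * n ^ 2 := by
  suffices h : ∀ p q r : ℤ, 0 ≤ p → 0 ≤ q → 0 ≤ r → p ≤ n → q ≤ n → r ≤ n → ∃ i j k : ℤ,
      28 * (7 * ((p - n * i) ^ 2 + (q - n * j) ^ 2 + (r - n * k) ^ 2)
      - 2 * (p - n * i + (q - n * j) + (r - n * k)) ^ 2) ≤ 53 * n ^ 2 by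
    obtain ⟨i, j, k, hijk⟩ := h (v.x % n) (v.y % n) (v.z % n) (Int.emod_nonneg _ hn.ne')
      (Int.emod_nonneg _ hn.ne') (Int.emod_nonneg _ hn.ne') (Int.emod_lt_of_pos _ hn).le
      (Int.emod_lt_of_pos _ hn).le (Int.emod_lt_of_pos _ hn).le
    refine ⟨⟨v.x / n + i, v.y / n + j, v.z / n + k⟩, ?_⟩
    rw [trace_sq]
    convert hijk using 2
    have hx := Int.emod_add_mul_ediv v.x n
    have hy := Int.emod_add_mul_ediv v.y n
    have hz := Int.emod_add_mul_ediv v.z n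
    have ex : (v - n * ⟨v.x / n + i, v.y / n + j, v.z / n + k⟩).x = v.x % n - n * i := by
      simp; linear_combination -hx
    have ey : (v - n * ⟨v.x / n + i, v.y / n + j, v.z / n + k⟩).y = v.y % n - n * j := by
      simp; linear_combination -hy
    have ez : (v - n * ⟨v.x / n + i, v.y / n + j, v.z / n + k⟩).z = v.z % n - n * k := by
      simp; linear_combination -hz
    rw [ex, ey, ez]
  intro p q r hp hq hr hp' hq' hr'
  rcases le_total p q with h1 | h1 <;> rcases le_total q r with h2 | h2 <;>
    rcases le_total p r with h3 | h3
  · obtain ⟨i, j, k, h⟩ := exists_close_of_le hn hp h1 h2 hr'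
    exact ⟨k, j, i, by linarith⟩
  · obtain ⟨i, j, k, h⟩ := exists_close_of_le hn hp h1 h2 hr'
    exact ⟨k, j, i, by linarith⟩
  · obtain ⟨i, j, k, h⟩ := exists_close_of_le hn hp h3 h2 hq'
    exact ⟨k, i, j, by linarith⟩
  · obtain ⟨i, j, k, h⟩ := exists_close_of_le hn hr h3 h1 hq'
    exact ⟨j, i, k, by linarith⟩
  · obtain ⟨i, j, k, h⟩ := exists_close_of_le hn hq h1 h3 hr'
    exact ⟨j, k, i, by linarith⟩
  · obtain ⟨i, j, k, h⟩ := exists_close_of_le hn hq h2 h3 hp'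
    exact ⟨i, k, j, by linarith⟩
  · obtain ⟨i, j, k, h⟩ := exists_close_of_le hn hr h2 h1 hp'
    exact ⟨i, j, k, by linarith⟩
  · obtain ⟨i, j, k, h⟩ := exists_close_of_le hn hr h2 h1 hp'
    exact ⟨i, j, k, by linarith⟩

lemma exists_reduced {φ : CubicInt →+* ℝ} {h : CubicInt} (hh : TotPos φ h) :
    ∃ e e' : CubicInt, e * e' = 1 ∧ Reduced (h * e ^ 2) := by
  obtain ⟨n, ⟨e, e', he, rfl⟩, hmin⟩ := WellFounded.has_min (wellFounded_lt (α := ℕ))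
    {n | ∃ e e' : CubicInt, e * e' = 1 ∧ (trace (h * e ^ 2)).toNat = n} ⟨_, 1, 1, one_mul 1, rfl⟩
  refine ⟨e, e', he, ?_⟩
  have key : ∀ u u' : CubicInt, u * u' = 1 →
      trace (h * e ^ 2) ≤ trace (h * e ^ 2 * u ^ 2) := by
    intro u u' hu
    have h1 : e * u * (e' * u') = 1 := by
      calc e * u * (e' * u') = (e * e') * (u * u') := by ring
        _ = 1 := by rw [he, hu, one_mul]
    have h2 := hmin _ ⟨e * u, e' * u', h1, rfl⟩
    have h3 := (hh.mul_unit_sq h1).trace_pos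
    rw [mul_pow, ← mul_assoc] at h2 h3
    omega
  generalize h * e ^ 2 = a at key
  have k1 := key ⟨1, 0, 0⟩ ⟨1, 1, 0⟩ rfl
  have k2 := key ⟨0, 1, 0⟩ ⟨0, 1, 1⟩ rfl
  have k3 := key ⟨0, 0, 1⟩ ⟨1, 0, 1⟩ rfl
  have k4 := key ⟨1, 1, 0⟩ ⟨1, 0, 0⟩ rfl
  have k5 := key ⟨0, 1, 1⟩ ⟨0, 1, 0⟩ rfl
  have k6 := key ⟨1, 0, 1⟩ ⟨0, 0, 1⟩ rfl
  simp only [trace, sq, mul_x, mul_y, mul_z] at k1 k2 k3 k4 k5 k6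
  unfold Reduced
  omega

/-- Hermite's inequality for binary forms: `a` is the first coefficient, assumed to have minimal
norm, `b` the middle one and `d` the determinant. -/
lemma norm_sq_le {φ : CubicInt →+* ℝ} {a b d : CubicInt} (ha : TotPos φ a) (hd : TotPos φ d)
    (hmin : ∀ x e e' : CubicInt, e * e' = 1 →
      norm a ^ 2 ≤ norm ((x * a + e * b) ^ 2 + e ^ 2 * d)) :
    norm a ^ 2 ≤ 42 * norm d := by
  obtain ⟨e, e', he, hred⟩ := exists_reduced (hd.mul (ha.adj.mul ha.adj))
  obtain ⟨w, hw⟩ := exists_trace_sq_sub_le (b * adj a * e) ha.norm_pos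
  have h1 := trace_cube_le hred
  have hh := (hd.mul (ha.adj.mul ha.adj)).mul_unit_sq he
  have h2 := (hh.add_sq (b * adj a * e - norm a * w)).am_gm
  have h3 : (b * adj a * e - norm a * w) ^ 2 + d * (adj a * adj a) * e ^ 2
      = ((-w * a + e * b) ^ 2 + e ^ 2 * d) * adj a ^ 2 := by
    rw [← mul_adj]; ring
  have h4 : trace ((b * adj a * e - norm a * w) ^ 2 + d * (adj a * adj a) * e ^ 2)
      = trace ((b * adj a * e - norm a * w) ^ 2) + trace (d * (adj a * adj a) * e ^ 2) := by
    simp only [trace, add_x, add_y, add_z]; ring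
  have h5 : norm (d * (adj a * adj a) * e ^ 2) = norm d * norm a ^ 4 := by
    rw [norm_mul, norm_mul, norm_mul, norm_pow, norm_unit_sq he, norm_adj]; ring
  rw [h4] at h2
  rw [h3, norm_mul, norm_pow, norm_adj] at h2
  rw [h5] at h1
  have hn := ha.norm_pos
  have h6 := hmin (-w) e e' he
  generalize trace (d * (adj a * adj a) * e ^ 2) = T at *
  generalize trace ((b * adj a * e - norm a * w) ^ 2) = S at *
  generalize norm ((-w * a + e * b) ^ 2 + e ^ 2 * d) = M at *
  generalize norm a = n at *
  generalize norm d = m at *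
  have h7 : (3 * n ^ 2) ^ 3 ≤ (S + T) ^ 3 := by
    calc (3 * n ^ 2) ^ 3 = 27 * (n ^ 2 * (n ^ 2) ^ 2) := by ring
      _ ≤ 27 * (M * (n ^ 2) ^ 2) := by gcongr
      _ ≤ _ := h2
  have h8 : 3 * n ^ 2 ≤ S + T := (Odd.strictMono_pow (by decide)).le_iff_le.1 h7
  have h9 : (31 * n ^ 2) ^ 3 ≤ (28 * T) ^ 3 :=
    (Odd.strictMono_pow (by decide)).monotone (by linarith)
  have h10 : 0 < n ^ 4 := by positivity
  have h11 : n ^ 4 * n ^ 2 ≤ n ^ 4 * (42 * m) := by nlinarith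
  exact le_of_mul_le_mul_left h11 h10

instance : DecidableEq CubicInt := fun a b =>
  decidable_of_iff (a.x = b.x ∧ a.y = b.y ∧ a.z = b.z) CubicInt.ext_iff.symm

lemma intCast_mul (n : ℤ) (a : CubicInt) : (n : CubicInt) * a = ⟨n * a.x, n * a.y, n * a.z⟩ := by
  ext <;> simp <;> ring

lemma intCast_mul_cancel {n : ℤ} (hn : n ≠ 0) {a b : CubicInt}
    (h : (n : CubicInt) * a = n * b) : a = b := by
  rw [intCast_mul, intCast_mul, CubicInt.mk.injEq] at h
  obtain ⟨hx, hy, hz⟩ := h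
  exact CubicInt.ext (mul_left_cancel₀ hn hx) (mul_left_cancel₀ hn hy) (mul_left_cancel₀ hn hz)

/-- Divisibility by `a`, tested on coordinates. -/
def Divides (a w : CubicInt) : Prop :=
  norm a ∣ (adj a * w).x ∧ norm a ∣ (adj a * w).y ∧ norm a ∣ (adj a * w).z

instance (a w : CubicInt) : Decidable (Divides a w) := by unfold Divides; infer_instance

lemma divides_iff {a w : CubicInt} (ha : norm a ≠ 0) : Divides a w ↔ a ∣ w := by
  constructor
  · rintro ⟨hx, hy, hz⟩
    obtain ⟨c, hc⟩ := intCast_dvd hx hy hz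
    refine ⟨c, intCast_mul_cancel ha ?_⟩
    rw [← mul_adj, mul_assoc, hc, ← mul_adj]; ring
  · rintro ⟨c, rfl⟩
    have h : adj a * (a * c) = norm a * c := by rw [← mul_adj]; ring
    rw [Divides, h, intCast_mul]
    exact ⟨⟨_, rfl⟩, ⟨_, rfl⟩, ⟨_, rfl⟩⟩

def box (l : List ℤ) : List CubicInt :=
  l.flatMap fun i => l.flatMap fun j => l.map fun k => ⟨i, j, k⟩

lemma mem_box {l : List ℤ} {a : CubicInt} (hx : a.x ∈ l) (hy : a.y ∈ l) (hz : a.z ∈ l) :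
    a ∈ box l := by
  simp only [box, List.mem_flatMap, List.mem_map]
  exact ⟨_, hx, _, hy, _, hz, rfl⟩

/-- The reduced totally positive elements of norm at most `42`. -/
def smallElements : List CubicInt :=
  [1, ⟨-3, -2, -2⟩, ⟨-2, -3, -2⟩, ⟨-2, -2, -3⟩, 2, ⟨-3, -3, -2⟩, ⟨-3, -2, -3⟩, ⟨-2, -3, -3⟩, 3,
    ⟨-4, -3, -3⟩, ⟨-3, -4, -3⟩, ⟨-3, -3, -4⟩, ⟨-4, -4, -3⟩, ⟨-4, -3, -4⟩, ⟨-3, -4, -4⟩]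

lemma mem_smallElements {φ : CubicInt →+* ℝ} {a : CubicInt} (ha : TotPos φ a) (hr : Reduced a)
    (hn : norm a ≤ 42) : a ∈ smallElements := by
  have h1 := trace_cube_le hr
  have h2 := ha.trace_pos
  have h3 : trace a ≤ 13 := by
    by_contra! h
    have : (14 : ℤ) ^ 3 ≤ trace a ^ 3 := by gcongr; omega
    omega
  have h4 : a ∈ box [-5, -4, -3, -2, -1] := by
    have hr' := hr
    unfold Reduced at hr'
    unfold trace at h2 h3
    apply mem_box <;> simp only [List.mem_cons, List.not_mem_nil, or_false] <;> omega
  have table : ∀ a ∈ box [-5, -4, -3, -2, -1], norm a ≤ 42 →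
      (3 * a.x - 4 * a.y + 3 * a.z ≤ 0 ∧ 3 * a.x + 3 * a.y - 4 * a.z ≤ 0 ∧
        -4 * a.x + 3 * a.y + 3 * a.z ≤ 0) ∧
      (a.x + 8 * a.y - 6 * a.z ≤ 0 ∧ -6 * a.x + a.y + 8 * a.z ≤ 0 ∧
        8 * a.x - 6 * a.y + a.z ≤ 0) → a ∈ smallElements := by
    decide +kernel
  exact table a h4 hn hr

/-- Representatives of the residue classes modulo a small element. -/
def residues (a : CubicInt) : List CubicInt :=
  if a = 2 ∨ a = 3 then box [0, 1, 2]
  else (List.range (norm a).toNat).map fun k : ℕ => ⟨k, 0, 0⟩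

lemma exists_residue {a : CubicInt} (ha : a ∈ smallElements) (b : CubicInt) :
    ∃ r ∈ residues a, a ∣ b - r := by
  by_cases h : a = 2 ∨ a = 3
  · have key : ∀ n : ℤ, n = 2 ∨ n = 3 →
        ∃ r ∈ box [0, 1, 2], (n : CubicInt) ∣ b - r := by
      intro n hn
      refine ⟨⟨b.x % n, b.y % n, b.z % n⟩, ?_, intCast_dvd ?_ ?_ ?_⟩
      · apply mem_box <;> simp only [List.mem_cons, List.not_mem_nil, or_false] <;>
          rcases hn with rfl | rfl <;> omega
      all_goals exact Int.dvd_self_sub_emod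
    rw [residues, if_pos h]
    rcases h with rfl | rfl
    · exact_mod_cast key 2 (Or.inl rfl)
    · exact_mod_cast key 3 (Or.inr rfl)
  · rw [residues, if_neg h]
    have table : ∀ a ∈ smallElements, ¬(a = 2 ∨ a = 3) → 0 < norm a ∧
        (∃ s ∈ List.range 41, Divides a ⟨-s, 1, 0⟩) ∧
        ∃ t ∈ List.range 41, Divides a ⟨-t, 0, 1⟩ := by
      decide +kernel
    obtain ⟨hn, ⟨s, -, hs⟩, t, -, ht⟩ := table a ha h
    rw [divides_iff hn.ne'] at hs ht
    have hu : a ∣ (norm a : CubicInt) := ⟨_, (mul_adj a).symm⟩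
    set k := b.x + s * b.y + t * b.z with hk
    have h0 := Int.emod_nonneg k hn.ne'
    refine ⟨⟨k % norm a, 0, 0⟩, List.mem_map.2 ⟨(k % norm a).toNat, ?_, ?_⟩, ?_⟩
    · have := Int.emod_lt_of_pos k hn
      rw [List.mem_range]; omega
    · rw [Int.toNat_of_nonneg h0]
    have h1 : b - ⟨k % norm a, 0, 0⟩ = norm a * ⟨k / norm a, 0, 0⟩
        + (((-b.y : ℤ) : CubicInt) * -⟨-s, 1, 0⟩ + ((-b.z : ℤ) : CubicInt) * -⟨-t, 0, 1⟩) := by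
      have := Int.emod_add_mul_ediv k (norm a)
      rw [intCast_mul, intCast_mul, intCast_mul]
      ext <;> simp
      linarith
    rw [h1]
    exact dvd_add (hu.mul_right _) (dvd_add ((dvd_neg.2 hs).mul_left _) ((dvd_neg.2 ht).mul_left _))

/-- No binary form of determinant `f` with first coefficient `a` has `a` as its minimum. -/
def Shrinks (a f : CubicInt) : Prop :=
  ∀ b, a ∣ b ^ 2 + f → ∃ x, norm ((b + a * x) ^ 2 + f) < norm a ^ 2

lemma shrinks_or_shrinks {a f : CubicInt} (ha : a ∈ smallElements) (hf : f ∈ smallElements)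
    (h1 : norm a ^ 2 ≤ 42 * norm f) (h2 : norm f ^ 2 ≤ 42 * norm a) :
    (a = 1 ∧ f = 1) ∨ Shrinks a f ∨ Shrinks f a := by
  have table : ∀ a ∈ smallElements, norm a ≠ 0 ∧ ∀ f ∈ smallElements,
      norm a * norm a ≤ 42 * norm f → norm f * norm f ≤ 42 * norm a → (a = 1 ∧ f = 1) ∨
      (∀ r ∈ residues a, Divides a (r * r + f) → ∃ x ∈ box [0, 1, -1],
        norm ((r + a * x) * (r + a * x) + f) < norm a * norm a) ∨
      (∀ r ∈ residues f, Divides f (r * r + a) → ∃ x ∈ box [0, 1, -1],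
        norm ((r + f * x) * (r + f * x) + a) < norm f * norm f) := by
    decide +kernel
  have key : ∀ a f, a ∈ smallElements → norm a ≠ 0 →
      (∀ r ∈ residues a, Divides a (r * r + f) → ∃ x ∈ box [0, 1, -1],
        norm ((r + a * x) * (r + a * x) + f) < norm a * norm a) → Shrinks a f := by
    intro a f ha hn h b hb
    obtain ⟨r, hr, c, hc⟩ := exists_residue ha b
    obtain rfl : b = r + a * c := by rw [← hc]; ring
    have h3 : a ∣ r * r + f := by
      have := dvd_sub hb (dvd_mul_right a (c * (2 * r + a * c)))
      convert this using 1; ring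
    obtain ⟨x, -, hx⟩ := h r hr ((divides_iff hn).2 h3)
    refine ⟨x - c, ?_⟩
    convert hx using 1
    · congr 1; ring
    · ring
  rw [sq] at h1 h2
  rcases (table a ha).2 f hf h1 h2 with h | h | h
  · exact Or.inl h
  · exact Or.inr (Or.inl (key a f ha (table a ha).1 h))
  · exact Or.inr (Or.inr (key f a hf (table f hf).1 h))

/-- The ternary quadratic form `a X² + 2b XY + 2c XZ + d Y² + 2e YZ + g Z²`. -/
structure TernaryForm where
  (a b c d e g : CubicInt)

namespace TernaryForm

def gram (F : TernaryForm) : Matrix (Fin 3) (Fin 3) CubicInt :=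
  !![F.a, F.b, F.c; F.b, F.d, F.e; F.c, F.e, F.g]

def minor (F : TernaryForm) : CubicInt := F.a * F.d - F.b ^ 2

def disc (F : TernaryForm) : CubicInt :=
  F.a * (F.d * F.g - F.e ^ 2) - F.b * (F.b * F.g - F.c * F.e) + F.c * (F.b * F.e - F.c * F.d)

/-- Unimodular and totally positive definite. -/
def Valid (φ : CubicInt →+* ℝ) (F : TernaryForm) : Prop :=
  TotPos φ F.a ∧ TotPos φ F.minor ∧ F.disc = 1

/-- Being a sum of three squares of linear forms. -/
def SumSq (F : TernaryForm) : Prop :=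
  ∃ M : Matrix (Fin 3) (Fin 3) CubicInt, M.transpose * M = F.gram

lemma SumSq.of_gram_eq {F G : TernaryForm} {U V : Matrix (Fin 3) (Fin 3) CubicInt}
    (hG : G.SumSq) (h : G.gram = U.transpose * F.gram * U) (hUV : U * V = 1) : F.SumSq := by
  obtain ⟨M, hM⟩ := hG
  have hVU : V.transpose * U.transpose = 1 := by
    rw [← Matrix.transpose_mul, hUV, Matrix.transpose_one]
  refine ⟨M * V, ?_⟩
  calc (M * V).transpose * (M * V) = V.transpose * (M.transpose * M) * V := by
        rw [Matrix.transpose_mul]; simp only [Matrix.mul_assoc]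
    _ = (V.transpose * U.transpose) * F.gram * (U * V) := by
        rw [hM, h]; simp only [Matrix.mul_assoc]
    _ = F.gram := by rw [hVU, hUV, Matrix.one_mul, Matrix.mul_one]

/-- Substitution of determinant one in the first two variables. -/
def changeFst (F : TernaryForm) (p q r s : CubicInt) : TernaryForm where
  a := p ^ 2 * F.a + 2 * p * r * F.b + r ^ 2 * F.d
  b := p * q * F.a + (p * s + q * r) * F.b + r * s * F.d
  c := p * F.c + r * F.e
  d := q ^ 2 * F.a + 2 * q * s * F.b + s ^ 2 * F.d
  e := q * F.c + s * F.e
  g := F.g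

/-- Substitution of determinant one in the last two variables. -/
def changeSnd (F : TernaryForm) (p q r s : CubicInt) : TernaryForm where
  a := F.a
  b := p * F.b + r * F.c
  c := q * F.b + s * F.c
  d := p ^ 2 * F.d + 2 * p * r * F.e + r ^ 2 * F.g
  e := p * q * F.d + (p * s + q * r) * F.e + r * s * F.g
  g := q ^ 2 * F.d + 2 * q * s * F.e + s ^ 2 * F.g

section

variable {φ : CubicInt →+* ℝ} {F : TernaryForm} {p q r s : CubicInt}

lemma minor_changeFst (h : p * s - q * r = 1) : (F.changeFst p q r s).minor = F.minor := by
  have : (F.changeFst p q r s).minor = F.minor * (p * s - q * r) ^ 2 := by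
    simp only [minor, changeFst]; ring
  rw [this, h, one_pow, mul_one]

lemma minor_changeSnd : (F.changeSnd p q r s).minor = p ^ 2 * F.minor
    + 2 * p * r * (F.a * F.e - F.b * F.c) + r ^ 2 * (F.a * F.g - F.c ^ 2) := by
  simp only [minor, changeSnd]; ring

lemma minor_mul_sub (F : TernaryForm) : F.minor * (F.a * F.g - F.c ^ 2)
    - (F.a * F.e - F.b * F.c) ^ 2 = F.a * F.disc := by
  simp only [minor, disc]; ring

lemma Valid.changeFst (hF : F.Valid φ) (h : p * s - q * r = 1) :
    (F.changeFst p q r s).Valid φ := by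
  refine ⟨hF.1.binary hF.2.1 h, by rw [minor_changeFst h]; exact hF.2.1, ?_⟩
  have : (F.changeFst p q r s).disc = F.disc * (p * s - q * r) ^ 2 := by
    simp only [disc, TernaryForm.changeFst]; ring
  rw [this, h, hF.2.2, one_pow, mul_one]

lemma Valid.changeSnd (hF : F.Valid φ) (h : p * s - q * r = 1) :
    (F.changeSnd p q r s).Valid φ := by
  refine ⟨hF.1, ?_, ?_⟩
  · rw [minor_changeSnd]
    refine hF.2.1.binary ?_ h
    rw [minor_mul_sub, hF.2.2, mul_one]
    exact hF.1
  · have : (F.changeSnd p q r s).disc = F.disc * (p * s - q * r) ^ 2 := by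
      simp only [disc, TernaryForm.changeSnd]; ring
    rw [this, h, hF.2.2, one_pow, mul_one]

lemma SumSq.of_changeFst (h : p * s - q * r = 1) (hF : (F.changeFst p q r s).SumSq) :
    F.SumSq := by
  refine hF.of_gram_eq (U := !![p, q, 0; r, s, 0; 0, 0, 1]) (V := !![s, -q, 0; -r, p, 0; 0, 0, 1])
    ?_ ?_
  · refine Matrix.ext fun i j => ?_
    fin_cases i <;> fin_cases j <;>
      simp [gram, changeFst, Matrix.mul_apply, Fin.sum_univ_three] <;> ring
  · rw [Matrix.one_fin_three]
    refine Matrix.ext fun i j => ?_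
    fin_cases i <;> fin_cases j <;> simp [Matrix.mul_apply, Fin.sum_univ_three] <;>
      first | ring1 | linear_combination h

lemma SumSq.of_changeSnd (h : p * s - q * r = 1) (hF : (F.changeSnd p q r s).SumSq) :
    F.SumSq := by
  refine hF.of_gram_eq (U := !![1, 0, 0; 0, p, q; 0, r, s]) (V := !![1, 0, 0; 0, s, -q; 0, -r, p])
    ?_ ?_
  · refine Matrix.ext fun i j => ?_
    fin_cases i <;> fin_cases j <;>
      simp [gram, changeSnd, Matrix.mul_apply, Fin.sum_univ_three] <;> ring
  · rw [Matrix.one_fin_three]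
    refine Matrix.ext fun i j => ?_
    fin_cases i <;> fin_cases j <;> simp [Matrix.mul_apply, Fin.sum_univ_three] <;>
      first | ring1 | linear_combination h

end

lemma exists_minimal {φ : CubicInt →+* ℝ} {F₀ : TernaryForm} (hF₀ : F₀.Valid φ)
    (hs₀ : ¬F₀.SumSq) : ∃ F : TernaryForm, F.Valid φ ∧ ¬F.SumSq ∧ Reduced F.a ∧ Reduced F.minor ∧
      (∀ x e e', e * e' = 1 → norm F.a ^ 2 ≤ norm ((x * F.a + e * F.b) ^ 2 + e ^ 2 * F.minor)) ∧
      (∀ x e e', e * e' = 1 → norm F.minor ^ 2 ≤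
        norm ((x * F.minor + e * (F.a * F.e - F.b * F.c)) ^ 2 + e ^ 2 * F.a)) := by
  obtain ⟨F₁, ⟨hv₁, hs₁⟩, hmin⟩ := WellFounded.has_min
    (InvImage.wf (fun F : TernaryForm => toLex ((norm F.a).toNat, (norm F.minor).toNat))
      (wellFounded_lt (α := ℕ ×ₗ ℕ))) {F | F.Valid φ ∧ ¬F.SumSq} ⟨F₀, hF₀, hs₀⟩
  obtain ⟨e, e', he, hr⟩ := exists_reduced hv₁.1
  obtain ⟨u, u', hu, hr'⟩ := exists_reduced hv₁.2.1
  have hdet : e * e' - 0 * 0 = 1 := by rw [he]; ring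
  have hdet' : u * u' - 0 * 0 = 1 := by rw [hu]; ring
  set F := (F₁.changeFst e 0 0 e').changeSnd u 0 0 u' with hF
  have ha : F.a = F₁.a * e ^ 2 := by simp only [hF, changeFst, changeSnd]; ring
  have hf : F.minor = F₁.minor * u ^ 2 := by
    rw [hF, minor_changeSnd, minor_changeFst hdet]; ring
  have hv : F.Valid φ := (hv₁.changeFst hdet).changeSnd hdet'
  have hna : norm F.a = norm F₁.a := by
    rw [ha, norm_mul, norm_pow, norm_unit_sq he, mul_one]
  have hnf : norm F.minor = norm F₁.minor := by
    rw [hf, norm_mul, norm_pow, norm_unit_sq hu, mul_one]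
  have hs : ¬F.SumSq := fun h => hs₁ ((h.of_changeSnd hdet').of_changeFst hdet)
  clear_value F
  have hmin' : ∀ G : TernaryForm, G.Valid φ → ¬G.SumSq →
      norm F.a ≤ norm G.a ∧ (norm G.a = norm F.a → norm F.minor ≤ norm G.minor) := by
    intro G hG hG'
    have h := hmin G ⟨hG, hG'⟩
    rw [InvImage, Prod.Lex.toLex_lt_toLex, ← hna, ← hnf] at h
    have := hG.1.norm_pos
    have := hG.2.1.norm_pos
    have := hv.1.norm_pos
    have := hv.2.1.norm_pos
    simp only at h
    omega
  refine ⟨F, hv, hs, ha ▸ hr, hf ▸ hr', ?_, ?_⟩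
  · intro x t t' ht
    have hdet : x * 0 - -t' * t = 1 := by rw [← ht]; ring
    have h := (hmin' _ (hv.changeFst hdet) fun h => hs (h.of_changeFst hdet)).1
    have h2 : (x * F.a + t * F.b) ^ 2 + t ^ 2 * F.minor
        = F.a * (F.changeFst x (-t') t 0).a := by
      simp only [minor, changeFst]; ring
    rw [h2, norm_mul, sq]
    exact mul_le_mul_of_nonneg_left h hv.1.norm_pos.le
  · intro x t t' ht
    have hdet : x * 0 - -t' * t = 1 := by rw [← ht]; ring
    have h := (hmin' _ (hv.changeSnd hdet) fun h => hs (h.of_changeSnd hdet)).2 rfl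
    have h3 := F.minor_mul_sub
    rw [hv.2.2, mul_one] at h3
    have h2 : (x * F.minor + t * (F.a * F.e - F.b * F.c)) ^ 2 + t ^ 2 * F.a
        = F.minor * (F.changeSnd x (-t') t 0).minor := by
      rw [minor_changeSnd]; linear_combination -t ^ 2 * h3
    rw [h2, norm_mul, sq]
    exact mul_le_mul_of_nonneg_left h hv.2.1.norm_pos.le

lemma sumSq_of_eq_one {F : TernaryForm} (ha : F.a = 1) (hf : F.minor = 1) (hd : F.disc = 1) :
    F.SumSq := by
  have h := F.minor_mul_sub
  rw [ha, hf, hd] at h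
  rw [minor, ha] at hf
  refine ⟨!![1, F.b, F.c; 0, 1, F.e - F.b * F.c; 0, 0, 1], ?_⟩
  refine Matrix.ext fun i j => ?_
  fin_cases i <;> fin_cases j <;> simp [gram, Matrix.mul_apply, Fin.sum_univ_three, ha]
  all_goals first | ring1 | linear_combination -hf | linear_combination -h

/-- Unimodular ternary forms over `ℤ[ω]` have class number one. -/
theorem Valid.sumSq {φ : CubicInt →+* ℝ} {F : TernaryForm} (hF : F.Valid φ) : F.SumSq := by
  by_contra hs
  obtain ⟨F, hv, hs, hra, hrf, h12, h23⟩ := exists_minimal hF hs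
  have h1 := norm_sq_le hv.1 hv.2.1 h12
  have h2 := norm_sq_le hv.2.1 hv.1 h23
  have hna := hv.1.norm_pos
  have hnf := hv.2.1.norm_pos
  have bound : ∀ x y : ℤ, 0 < x → x ^ 2 ≤ 42 * y → y ^ 2 ≤ 42 * x → x ≤ 42 := by
    intro x y hx hxy hyx
    by_contra! h
    have : x < y := by nlinarith
    nlinarith
  have key : ∀ a f b d : CubicInt, a * d = b ^ 2 + f →
      (∀ x e e', e * e' = 1 → norm a ^ 2 ≤ norm ((x * a + e * b) ^ 2 + e ^ 2 * f)) →
      ¬Shrinks a f := by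
    intro a f b d h hmin hg
    obtain ⟨x, hx⟩ := hg b ⟨d, h.symm⟩
    have := hmin x 1 1 (one_mul 1)
    rw [show (x * a + 1 * b) ^ 2 + 1 ^ 2 * f = (b + a * x) ^ 2 + f by ring] at this
    omega
  rcases shrinks_or_shrinks (mem_smallElements hv.1 hra (bound _ _ hna h1 h2))
    (mem_smallElements hv.2.1 hrf (bound _ _ hnf h2 h1)) h1 h2 with ⟨ha, hf⟩ | h | h
  · exact hs (sumSq_of_eq_one ha hf hv.2.2)
  · exact key _ _ F.b F.d (by rw [minor]; ring) h12 h
  · refine key _ _ _ (F.a * F.g - F.c ^ 2) ?_ h23 h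
    have h3 := F.minor_mul_sub
    rw [hv.2.2] at h3
    linear_combination h3

end TernaryForm

lemma exists_prime_of_mod_eight {N : ℕ} (hN : N % 8 = 3) : ∃ p c : ℕ, p.Prime ∧ 0 < c ∧
    2 * p + 1 = 7 * N * c ∧ p % 4 = 3 ∧ p % 7 = 3 ∧ jacobiSym (-N) p = 1 := by
  obtain ⟨n, rfl⟩ : ∃ n, N = 8 * n + 3 := ⟨N / 8, by omega⟩
  have hcop : (84 * n + 31).Coprime (4 * (56 * n + 21)) := by
    apply Nat.Coprime.mul_right
    · rw [← Nat.isCoprime_iff_coprime]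
      exact ⟨-1, 21 * n + 8, by push_cast; ring⟩
    · rw [← Nat.isCoprime_iff_coprime]
      exact ⟨-2, 3, by push_cast; ring⟩
  obtain ⟨p, hlt, hp, hmod⟩ :=
    Nat.forall_exists_prime_gt_and_modEq (84 * n + 31) (by omega) hcop
  obtain ⟨j, hj⟩ := (Nat.modEq_iff_dvd' hlt.le).1 hmod.symm
  have hpj : p = 84 * n + 31 + 224 * (n * j) + 84 * j := by
    have h := Nat.add_sub_cancel' hlt.le
    rw [hj] at h
    rw [← h]; ring
  have hc : 2 * p + 1 = 7 * (8 * n + 3) * (8 * j + 3) := by rw [hpj]; ring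
  have hp4 : p % 4 = 3 := by omega
  refine ⟨p, 8 * j + 3, hp, by omega, hc, hp4, by omega, ?_⟩
  have hpo : Odd p := Nat.odd_iff.2 (by omega)
  have hNo : Odd (8 * n + 3) := Nat.odd_iff.2 (by omega)
  have h1 : jacobiSym (2 * p) (8 * n + 3) = -1 := by
    rw [jacobiSym.mod_left' (a₂ := -1), jacobiSym.at_neg_one hNo,
      ZMod.χ₄_nat_three_mod_four (by omega)]
    apply Int.ModEq.symm
    rw [Int.modEq_iff_dvd]
    refine ⟨7 * (8 * j + 3), ?_⟩
    have : (2 * p + 1 : ℤ) = 7 * (8 * n + 3) * (8 * j + 3) := by exact_mod_cast hc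
    push_cast
    linear_combination this
  rw [jacobiSym.mul_left, jacobiSym.at_two hNo, ZMod.χ₈_nat_eq_if_mod_eight] at h1
  have h2 : jacobiSym p (8 * n + 3) = 1 := by
    rw [if_neg (by omega), if_neg (by omega)] at h1
    linarith
  rw [← neg_one_mul, jacobiSym.mul_left, jacobiSym.at_neg_one hpo,
    ZMod.χ₄_nat_three_mod_four hp4, jacobiSym.quadratic_reciprocity_three_mod_four (by omega) hp4,
    h2]
  norm_num

lemma ringHom_ext {R : Type*} [Ring R] {f g : CubicInt →+* R}
    (h : f ⟨1, 0, 0⟩ = g ⟨1, 0, 0⟩) : f = g := by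
  ext a
  have ha : a = (a.x - a.z : ℤ) * ⟨1, 0, 0⟩ + (a.y - a.z : ℤ) * (⟨1, 0, 0⟩ * ⟨1, 0, 0⟩ - 2)
      - (a.z : CubicInt) := by
    ext <;> simp <;> ring
  rw [ha]
  simp only [map_add, map_sub, map_mul, map_intCast, map_ofNat, h]

open Polynomial in
lemma eval_dickson (k : ℕ) : (dickson 1 (1 : CubicInt) (7 * k)).eval ⟨1, 0, 0⟩ = 2 ∧
    (dickson 1 (1 : CubicInt) (7 * k + 1)).eval ⟨1, 0, 0⟩ = ⟨1, 0, 0⟩ ∧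
    (dickson 1 (1 : CubicInt) (7 * k + 3)).eval ⟨1, 0, 0⟩ = ⟨0, 0, 1⟩ := by
  have step (n : ℕ) : (dickson 1 (1 : CubicInt) (n + 2)).eval ⟨1, 0, 0⟩ =
      ⟨1, 0, 0⟩ * (dickson 1 (1 : CubicInt) (n + 1)).eval ⟨1, 0, 0⟩
        - (dickson 1 (1 : CubicInt) n).eval ⟨1, 0, 0⟩ := by
    simp [dickson_add_two]
  have h3 (n : ℕ) (h0 : (dickson 1 (1 : CubicInt) n).eval ⟨1, 0, 0⟩ = 2)
      (h1 : (dickson 1 (1 : CubicInt) (n + 1)).eval ⟨1, 0, 0⟩ = ⟨1, 0, 0⟩) :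
      (dickson 1 (1 : CubicInt) (n + 3)).eval ⟨1, 0, 0⟩ = ⟨0, 0, 1⟩ := by
    rw [step (n + 1), step n, h0, h1]; rfl
  suffices h : (dickson 1 (1 : CubicInt) (7 * k)).eval ⟨1, 0, 0⟩ = 2 ∧
      (dickson 1 (1 : CubicInt) (7 * k + 1)).eval ⟨1, 0, 0⟩ = ⟨1, 0, 0⟩ from
    ⟨h.1, h.2, h3 _ h.1 h.2⟩
  induction k with
  | zero =>
    refine ⟨?_, ?_⟩
    · rw [dickson_zero]; norm_num
    · rw [dickson_one]; simp
  | succ k ih =>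
    obtain ⟨h0, h1⟩ := ih
    rw [mul_add, mul_one]
    refine ⟨?_, ?_⟩
    · rw [step (7 * k + 5), step (7 * k + 4), step (7 * k + 3), step (7 * k + 2), step (7 * k + 1),
        step (7 * k), h0, h1]; rfl
    · rw [step (7 * k + 6), step (7 * k + 5), step (7 * k + 4), step (7 * k + 3), step (7 * k + 2),
        step (7 * k + 1), step (7 * k), h0, h1]; rfl

open Polynomial in
/-- The Frobenius at a prime `p ≡ 3 (mod 7)`. -/
lemma dvd_pow_sub_conj {p : ℕ} (hp : p.Prime) (hp7 : p % 7 = 3) (a : CubicInt) :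
    (p : CubicInt) ∣ a ^ p - conj (conj a) := by
  have : Fact p.Prime := ⟨hp⟩
  have hnu : (p : CubicInt) ∈ nonunits CubicInt := by
    intro hu
    obtain ⟨b, hb⟩ := hu.exists_right_inv
    have h1 : (p : ℤ) ∣ 1 := ⟨-b.x, by
      have := congrArg CubicInt.x hb
      rw [← Int.cast_natCast, intCast_mul] at this
      simp only [one_x] at this
      linarith⟩
    exact hp.one_lt.ne' (by exact_mod_cast Int.eq_one_of_dvd_one (by positivity) h1)
  have := CharP.quotient CubicInt p hnu
  rw [← Ideal.mem_span_singleton, ← Ideal.Quotient.mk_eq_mk_iff_sub_mem, map_pow]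
  set π := Ideal.Quotient.mk (Ideal.span {(p : CubicInt)})
  suffices h : (frobenius _ p).comp π = π.comp (conj.comp conj) from RingHom.congr_fun h a
  apply ringHom_ext
  have h1 := (eval_dickson (p / 7)).2.2
  rw [show 7 * (p / 7) + 3 = p by omega] at h1
  have h2 := congrArg π h1
  rw [← eval_map_apply, map_dickson, map_one, dickson_one_one_charP, eval_pow, eval_X] at h2
  exact h2

lemma exists_sq_sub_dvd_two (b : CubicInt) : (2 : CubicInt) ∣ conj (conj b) ^ 2 - b := by
  have h (n : ℤ) : (2 : ℤ) ∣ n * n - n := by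
    have := (Int.even_mul_pred_self n).two_dvd
    rwa [mul_sub, mul_one] at this
  have h2 := intCast_dvd (n := 2) (a := conj (conj b) ^ 2 - b) ?_ ?_ ?_
  · exact_mod_cast h2
  · obtain ⟨c, hc⟩ := h b.x
    refine ⟨-b.y * b.y - b.z * b.z - c - b.x + b.y * b.z + b.z * b.x, ?_⟩
    simp only [sq, sub_x, mul_x, conj_x, conj_y, conj_z]
    linear_combination -hc
  · obtain ⟨c, hc⟩ := h b.y
    refine ⟨-b.x * b.x - b.z * b.z - c - b.y + b.x * b.z + b.y * b.x, ?_⟩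
    simp only [sq, sub_y, mul_y, conj_x, conj_y, conj_z]
    linear_combination -hc
  · obtain ⟨c, hc⟩ := h b.z
    refine ⟨-b.x * b.x - b.y * b.y - c - b.z + b.x * b.y + b.y * b.z, ?_⟩
    simp only [sq, sub_z, mul_z, conj_x, conj_y, conj_z]
    linear_combination -hc

/-- Modulo a prime `p ≡ 3 (mod 4)` inert in the cubic field, an element is a square as soon as
its norm is a square modulo `p`. -/
lemma exists_sq_sub_dvd_prime {p : ℕ} (hp : p.Prime) (hp4 : p % 4 = 3) (hp7 : p % 7 = 3)
    {y : CubicInt} (hy : jacobiSym (norm y) p = 1) : ∃ s : CubicInt, (p : CubicInt) ∣ s ^ 2 - y := by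
  have : Fact p.Prime := ⟨hp⟩
  have h1 : (p : CubicInt) ∣ (norm y : CubicInt) ^ (p / 2) - 1 := by
    have h := legendreSym.eq_pow p (norm y)
    rw [jacobiSym.legendreSym.to_jacobiSym, hy] at h
    have h2 : ((norm y ^ (p / 2) - 1 : ℤ) : ZMod p) = 0 := by push_cast; rw [← h]; simp
    obtain ⟨c, hc⟩ := (ZMod.intCast_zmod_eq_zero_iff_dvd _ p).1 h2
    exact ⟨c, by exact_mod_cast congrArg (Int.cast (R := CubicInt)) hc⟩
  have h2 : (p : CubicInt) ∣ y ^ (1 + p + p ^ 2) - norm y := by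
    have h3 := dvd_pow_sub_conj hp hp7 y
    have h4 := dvd_pow_sub_conj hp hp7 (y ^ p)
    have h5 := map_dvd (conj.comp conj) h3
    simp only [RingHom.comp_apply, map_sub, map_pow, map_natCast, conj_conj_conj] at h4 h5
    have h6 := dvd_add h4 h5
    have h7 : y ^ (1 + p + p ^ 2) - norm y = y * (y ^ p * ((y ^ p) ^ p - conj (conj y) ^ p
        + (conj (conj y) ^ p - conj y)) + conj y * (y ^ p - conj (conj y))) := by
      rw [← mul_adj, adj]; ring
    rw [h7]
    exact (dvd_add (h6.mul_left _) (h3.mul_left _)).mul_left _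
  have h3 : (p : CubicInt) ∣ (y ^ (1 + p + p ^ 2)) ^ (p / 2) - 1 := by
    have := dvd_add (h2.trans (sub_dvd_pow_sub_pow _ _ (p / 2))) h1
    rwa [sub_add_sub_cancel] at this
  obtain ⟨k, hk⟩ : Even (1 + (1 + p + p ^ 2) * (p / 2)) := by
    have ho : Odd p := Nat.odd_iff.2 (by omega)
    have hh : Odd (p / 2) := Nat.odd_iff.2 (by omega)
    have : Odd (1 + p + p ^ 2) := (odd_one.add_odd ho).add_odd ho.pow
    exact odd_one.add_odd (this.mul hh)
  refine ⟨y ^ k, ?_⟩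
  have h4 : (y ^ k) ^ 2 - y = y * ((y ^ (1 + p + p ^ 2)) ^ (p / 2) - 1) := by
    rw [← pow_mul, mul_two, ← hk, pow_add, pow_mul, pow_one]; ring
  rw [h4]
  exact h3.mul_left _

/-- A totally positive element of norm `3` modulo `8` is a coefficient of a unimodular form. -/
lemma exists_form {φ : CubicInt →+* ℝ} {α : CubicInt} (hα : TotPos φ α) (hN : norm α % 8 = 3) :
    ∃ F : TernaryForm, F.Valid φ ∧ F.g = α := by
  obtain ⟨N, hNN⟩ := Int.eq_ofNat_of_zero_le hα.norm_pos.le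
  obtain ⟨p, c, hp, hc0, hpc, hp4, hp7, hJ⟩ := exists_prime_of_mod_eight (N := N) (by omega)
  have hneg : norm (-α) = -N := by
    rw [← hNN]; simp only [norm_eq, neg_x, neg_y, neg_z]; ring
  obtain ⟨s₁, hs₁⟩ := exists_sq_sub_dvd_prime hp hp4 hp7 (y := -α) (by rw [hneg]; exact hJ)
  set b : CubicInt := ((7 * c : ℕ) : ℤ) * adj α with hb
  have hbpos : TotPos φ b := (TotPos.intCast (by positivity)).mul hα.adj
  have hαb : α * b = 2 * p + 1 := by
    have h : ((2 * p + 1 : ℕ) : CubicInt) = ((7 * N * c : ℕ) : CubicInt) := by rw [hpc]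
    have h2 := mul_adj α
    rw [hNN] at h2
    push_cast at h h2
    rw [hb, h]
    push_cast
    linear_combination (7 * c : CubicInt) * h2
  obtain ⟨t, ht⟩ : ∃ t, (2 : CubicInt) ∣ t ^ 2 - b := ⟨_, exists_sq_sub_dvd_two b⟩
  obtain ⟨q, rfl⟩ : ∃ q, p = 2 * q + 1 := ⟨p / 2, by omega⟩
  push_cast at *
  set P : CubicInt := 2 * q + 1 with hP
  set s := P * t + (P + 1) * (s₁ * b) with hs
  have hpdvd : P ∣ s ^ 2 + b := by
    obtain ⟨u, hu⟩ := hs₁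
    refine ⟨P * t ^ 2 + 2 * t * (P + 1) * (s₁ * b) + (P + 2) * (s₁ * b) ^ 2 + u * b ^ 2 - 2 * b, ?_⟩
    rw [hs]
    linear_combination b ^ 2 * hu - b * hαb
  have h2dvd : (2 : CubicInt) ∣ s ^ 2 + b := by
    obtain ⟨u, hu⟩ := ht
    refine ⟨P ^ 2 * u + b * (2 * q ^ 2 + 2 * q + 1) + P * t * (2 * (q + 1)) * (s₁ * b)
      + 2 * (q + 1) ^ 2 * (s₁ * b) ^ 2, ?_⟩
    rw [hs, hP]
    linear_combination P ^ 2 * hu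
  obtain ⟨a, ha⟩ : 2 * P ∣ s ^ 2 + b := by
    obtain ⟨u, hu⟩ := hpdvd
    obtain ⟨v, hv⟩ := h2dvd
    exact ⟨v - q * u, by rw [hP] at *; linear_combination (2 * q + 1) * hv - 2 * q * hu⟩
  refine ⟨⟨a, s, 1, 2 * P, 0, α⟩, ⟨?_, ?_, ?_⟩, rfl⟩
  · have h : TotPos φ (s ^ 2 + b) := hbpos.add_sq s
    have key : ∀ ψ : CubicInt →+* ℝ, 0 < ψ (s ^ 2 + b) → 0 < ψ a := by
      intro ψ h
      rw [ha, hP] at h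
      simp only [map_mul, map_add, map_ofNat, map_natCast, map_one] at h
      exact pos_of_mul_pos_right h (by positivity)
    exact ⟨key φ h.1, key (φ.comp conj) h.2.1, key ((φ.comp conj).comp conj) h.2.2⟩
  · have : TernaryForm.minor ⟨a, s, 1, 2 * P, 0, α⟩ = b := by
      simp only [TernaryForm.minor]; linear_combination -ha
    rw [this]; exact hbpos
  · simp only [TernaryForm.disc]
    linear_combination hαb - α * ha

/-- The real embedding determined by a root of the defining cubic polynomial. -/
def toReal (ω : ℝ) (hω : ω ^ 3 + ω ^ 2 - 2 * ω - 1 = 0) : CubicInt →+* ℝ where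
  toFun a := a.x * ω + a.y * (ω ^ 2 - 2) + a.z * (1 - ω - ω ^ 2)
  map_one' := by simp only [one_x, one_y, one_z]; push_cast; ring
  map_mul' a b := by
    simp only [mul_x, mul_y, mul_z]
    push_cast
    linear_combination -((a.x * b.y + a.y * b.x) + (ω - 1) * a.y * b.y - (a.x * b.z + a.z * b.x)
      - ω * (a.y * b.z + a.z * b.y) + (ω + 1) * a.z * b.z) * hω
  map_zero' := by simp
  map_add' a b := by simp only [add_x, add_y, add_z]; push_cast; ring

lemma toReal_mem (ω : ℝ) (hω : ω ^ 3 + ω ^ 2 - 2 * ω - 1 = 0) (a : CubicInt) :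
    toReal ω hω a ∈ Algebra.adjoin ℤ {ω} := by
  have h : ω ∈ Algebra.adjoin ℤ {ω} := Algebra.self_mem_adjoin_singleton ℤ ω
  have h2 : (2 : ℝ) ∈ Algebra.adjoin ℤ {ω} := ofNat_mem _ 2
  exact add_mem (add_mem (mul_mem (intCast_mem _ _) h)
    (mul_mem (intCast_mem _ _) (sub_mem (pow_mem h 2) h2)))
    (mul_mem (intCast_mem _ _) (sub_mem (sub_mem (one_mem _) h) (pow_mem h 2)))

lemma toReal_apply_root (ω : ℝ) (hω : ω ^ 3 + ω ^ 2 - 2 * ω - 1 = 0) :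
    toReal ω hω ⟨1, 0, 0⟩ = ω := by
  change ((1 : ℤ) : ℝ) * ω + ((0 : ℤ) : ℝ) * (ω ^ 2 - 2) + ((0 : ℤ) : ℝ) * (1 - ω - ω ^ 2) = ω
  push_cast; ring

lemma map_root (ψ : CubicInt →+* ℝ) :
    ψ ⟨1, 0, 0⟩ ^ 3 + ψ ⟨1, 0, 0⟩ ^ 2 - 2 * ψ ⟨1, 0, 0⟩ - 1 = 0 := by
  have h : (⟨1, 0, 0⟩ : CubicInt) ^ 3 + ⟨1, 0, 0⟩ ^ 2 - 2 * ⟨1, 0, 0⟩ - 1 = 0 := by decide +kernel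
  have h' := congrArg ψ h
  simpa only [map_sub, map_add, map_mul, map_pow, map_one, map_ofNat, map_zero] using h'

theorem exists_three_sq {φ : CubicInt →+* ℝ} {α : CubicInt} (hα : TotPos φ α)
    (hN : norm α % 8 = 3) : ∃ x y z : CubicInt, α = x ^ 2 + y ^ 2 + z ^ 2 := by
  obtain ⟨F, hF, rfl⟩ := exists_form hα hN
  obtain ⟨M, hM⟩ := hF.sumSq
  refine ⟨M 0 2, M 1 2, M 2 2, ?_⟩
  have h := congrFun (congrFun hM 2) 2
  simp only [Matrix.mul_apply, Fin.sum_univ_three, Matrix.transpose_apply] at h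
  rw [sq, sq, sq, h]
  rfl

lemma norm_sub_emod_eight {n m : ℤ} (h1 : n % 32 = 28) (h2 : m % 8 = 5) :
    norm ((n : CubicInt) - m * ⟨1, 0, 0⟩ ^ 2) % 8 = 3 := by
  obtain ⟨a, rfl⟩ : ∃ a, n = 4 * a := ⟨n / 4, by omega⟩
  obtain ⟨l, rfl⟩ : ∃ l, m = 8 * l + 5 := ⟨m / 8, by omega⟩
  have h : norm (((4 * a : ℤ) : CubicInt) - ((8 * l + 5 : ℤ) : CubicInt) * ⟨1, 0, 0⟩ ^ 2)
      = 8 * (8 * a ^ 3 - 10 * a ^ 2 * (8 * l + 5) + 3 * a * (8 * l + 5) ^ 2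
        - (64 * l ^ 3 + 120 * l ^ 2 + 75 * l + 16)) + 3 := by
    rw [sq (⟨1, 0, 0⟩ : CubicInt), intCast_mul]
    simp only [norm_eq, sub_x, sub_y, sub_z, mul_x, mul_y, mul_z, intCast_x, intCast_y, intCast_z]
    ring
  omega

end CubicInt

lemma sq_lt_of_cubic {r : ℝ} (hr : r ^ 3 + r ^ 2 - 2 * r - 1 = 0) : 4 * r ^ 2 < 13 := by
  have h : (r ^ 2) ^ 3 - 5 * (r ^ 2) ^ 2 + 6 * r ^ 2 - 1 = 0 := by
    linear_combination (r ^ 3 - r ^ 2 - 2 * r + 1) * hr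
  generalize r ^ 2 = s at h
  by_contra! hs
  nlinarith [mul_nonneg (sub_nonneg.2 hs) (sq_nonneg (4 * s - 13)), sq_nonneg (4 * s - 13)]

/-- Let `ω = ζ₇ + ζ₇⁻¹` be a (real) root of `T³ + T² − 2T − 1`, so that
`ℤ[ω]` is the ring of integers of the totally real cubic field `K₄₉ = ℚ(ω)` (this subring of
`ℝ` does not depend on the choice of root, as `K₄₉/ℚ` is Galois). Let `n, m` be positive
integers with `n ≡ 28 (mod 32)`, `m ≡ 5 (mod 8)` and `3.25 m < n < 4 m`. Then `n − m ω²` is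
totally positive (all its conjugates `n − m ω'²`, for `ω'` a root of the cubic, are positive)
and is a sum of three squares in `ℤ[ω]`; in particular
`n = w² + x² + y² + m z²` for some `w, x, y, z ∈ ℤ[ω]`. -/
theorem statement6 (ω : ℝ) (hω : ω ^ 3 + ω ^ 2 - 2 * ω - 1 = 0)
    (n m : ℤ) (hn : 0 < n) (hm : 0 < m)
    (h1 : n % 32 = 28) (h2 : m % 8 = 5)
    (h3 : 13 * m < 4 * n) (h4 : 4 * n < 16 * m) :
    (∀ ω' : ℝ, ω' ^ 3 + ω' ^ 2 - 2 * ω' - 1 = 0 → 0 < (n : ℝ) - m * ω' ^ 2) ∧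
    (∃ x y z : ℝ, x ∈ Algebra.adjoin ℤ {ω} ∧ y ∈ Algebra.adjoin ℤ {ω} ∧
      z ∈ Algebra.adjoin ℤ {ω} ∧
      (n : ℝ) - m * ω ^ 2 = x ^ 2 + y ^ 2 + z ^ 2) ∧
    (∃ w x y z : ℝ, w ∈ Algebra.adjoin ℤ {ω} ∧ x ∈ Algebra.adjoin ℤ {ω} ∧
      y ∈ Algebra.adjoin ℤ {ω} ∧ z ∈ Algebra.adjoin ℤ {ω} ∧
      (n : ℝ) = w ^ 2 + x ^ 2 + y ^ 2 + m * z ^ 2) := by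
  have hpos : ∀ r : ℝ, r ^ 3 + r ^ 2 - 2 * r - 1 = 0 → 0 < (n : ℝ) - m * r ^ 2 := by
    intro r hr
    have hm' : (0 : ℝ) < m := by exact_mod_cast hm
    have h3' : (13 * m : ℝ) < 4 * n := by exact_mod_cast h3
    nlinarith [mul_lt_mul_of_pos_left (sq_lt_of_cubic hr) hm']
  set φ := CubicInt.toReal ω hω
  have hψ : ∀ ψ : CubicInt →+* ℝ, ψ ((n : CubicInt) - m * ⟨1, 0, 0⟩ ^ 2)
      = n - m * ψ ⟨1, 0, 0⟩ ^ 2 := by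
    intro ψ
    rw [map_sub, map_mul, map_pow, map_intCast, map_intCast]
  have key : ∀ ψ : CubicInt →+* ℝ, 0 < ψ ((n : CubicInt) - m * ⟨1, 0, 0⟩ ^ 2) := by
    intro ψ
    rw [hψ]
    exact hpos _ (CubicInt.map_root ψ)
  have htp : CubicInt.TotPos φ ((n : CubicInt) - m * ⟨1, 0, 0⟩ ^ 2) :=
    ⟨key φ, key (φ.comp CubicInt.conj), key ((φ.comp CubicInt.conj).comp CubicInt.conj)⟩
  obtain ⟨x, y, z, hxyz⟩ := CubicInt.exists_three_sq htp (CubicInt.norm_sub_emod_eight h1 h2)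
  have hsum : (n : ℝ) - m * ω ^ 2 = φ x ^ 2 + φ y ^ 2 + φ z ^ 2 := by
    have h := congrArg φ hxyz
    rw [hψ, CubicInt.toReal_apply_root] at h
    simpa using h
  have hmem : ∀ a, φ a ∈ Algebra.adjoin ℤ {ω} := CubicInt.toReal_mem ω hω
  exact ⟨hpos, ⟨φ x, φ y, φ z, hmem x, hmem y, hmem z, hsum⟩,
    φ x, φ y, φ z, ω, hmem x, hmem y, hmem z, Algebra.self_mem_adjoin_singleton ℤ ω,
    by linear_combination hsum⟩
end

section
/- Let ω = ζ₇ + ζ₇⁻¹, a root of T³ + T² − 2T − 1. There exists an infinite set T of integers k ≥ 4 such that: (1) for distinct k, l ∈ T, the quadratic forms ⟨1,1,1,8k+5⟩ and ⟨1,1,1,8l+5⟩ are not equivalent (isometric) over ℚ; and (2) for every k ∈ T there exists a positive integer n represented by ⟨1,1,1,8k+5⟩ over ℤ[ω] but not over ℤ. In particular, there exist infinitely many quadratic forms of rank 4 over ℤ, pairwise non-isometric over ℚ, each of which represents some rational integer over the ring of integers of the totally real cubic field ℚ(ω) that it does not represent over ℤ. -/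
/-- Isometric diagonal forms `⟨1,1,1,a⟩` and `⟨1,1,1,b⟩` have the same discriminant up to squares. -/
theorem exists_sq_mul_eq_of_isometry {a b : ℚ} (M : Matrix (Fin 4) (Fin 4) ℚ)
    (h : ∀ x : Fin 4 → ℚ,
      (M.mulVec x 0) ^ 2 + (M.mulVec x 1) ^ 2 + (M.mulVec x 2) ^ 2 + a * (M.mulVec x 3) ^ 2
        = (x 0) ^ 2 + (x 1) ^ 2 + (x 2) ^ 2 + b * (x 3) ^ 2) :
    a * M.det ^ 2 = b := by
  have polar (x y : Fin 4 → ℚ) :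
      M.mulVec x 0 * M.mulVec y 0 + M.mulVec x 1 * M.mulVec y 1 + M.mulVec x 2 * M.mulVec y 2
          + a * (M.mulVec x 3 * M.mulVec y 3)
        = x 0 * y 0 + x 1 * y 1 + x 2 * y 2 + b * (x 3 * y 3) := by
    have hxy := h (x + y)
    simp only [Matrix.mulVec_add, Pi.add_apply] at hxy
    linear_combination (hxy - h x - h y) / 2
  have key : M.transpose * Matrix.diagonal ![1, 1, 1, a] * M = Matrix.diagonal ![1, 1, 1, b] := by
    ext i j
    have hij := polar (Pi.single i 1) (Pi.single j 1)
    simp only [Matrix.mulVec_single_one, Matrix.col_apply] at hij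
    have hl : (M.transpose * Matrix.diagonal ![1, 1, 1, a] * M) i j
        = M 0 i * M 0 j + M 1 i * M 1 j + M 2 i * M 2 j + a * (M 3 i * M 3 j) := by
      rw [Matrix.mul_apply]
      simp only [Matrix.mul_diagonal, Fin.sum_univ_four, Matrix.transpose_apply]
      simp
      ring
    rw [hl, hij]
    fin_cases i <;> fin_cases j <;> simp
  have hdet := congrArg Matrix.det key
  simp only [Matrix.det_mul, Matrix.det_transpose, Matrix.det_diagonal, Fin.prod_univ_four] at hdet
  simp at hdet
  linear_combination hdet

theorem Int.sq_add_sq_add_sq_ne_of_emod_eight {a b c n : ℤ} (hn : n % 8 = 7) :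
    a ^ 2 + b ^ 2 + c ^ 2 ≠ n := by
  have sq_emod (x : ℤ) : x ^ 2 % 8 = 0 ∨ x ^ 2 % 8 = 1 ∨ x ^ 2 % 8 = 4 := by
    rcases (by omega : x % 8 = 0 ∨ x % 8 = 1 ∨ x % 8 = 2 ∨ x % 8 = 3 ∨ x % 8 = 4 ∨ x % 8 = 5 ∨
      x % 8 = 6 ∨ x % 8 = 7) with h | h | h | h | h | h | h | h <;> simp [pow_two, Int.mul_emod, h]
  have := sq_emod a
  have := sq_emod b
  have := sq_emod c
  omega

theorem Int.sq_add_sq_add_sq_ne_of_emod_thirty_two {a b c n : ℤ} (hn : n % 32 = 28) :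
    a ^ 2 + b ^ 2 + c ^ 2 ≠ n := by
  intro h
  have parity (x : ℤ) : ∃ y, x = 2 * y ∧ x ^ 2 = 4 * y ^ 2 ∨ x ^ 2 = 4 * y + 1 := by
    obtain ⟨y, rfl | rfl⟩ := Int.even_or_odd' x
    · exact ⟨y, Or.inl ⟨rfl, by ring⟩⟩
    · exact ⟨y ^ 2 + y, Or.inr (by ring)⟩
  obtain ⟨x, hx⟩ := parity a
  obtain ⟨y, hy⟩ := parity b
  obtain ⟨z, hz⟩ := parity c
  have hsum : x ^ 2 + y ^ 2 + z ^ 2 = n / 4 := by omega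
  exact Int.sq_add_sq_add_sq_ne_of_emod_eight (by omega) hsum

/-- If `n < 4 * m`, then `n` can only be represented by `⟨1,1,1,m⟩` with last coordinate `0` or
`±1`; the congruences exclude these. -/
theorem Int.not_exists_sq_add_sq_add_sq_add_mul_sq {m n : ℤ} (hm₀ : 0 < m) (hm : m % 8 = 5)
    (hn : n % 32 = 28) (hnm : n < 4 * m) : ¬ ∃ w x y z : ℤ, n = w ^ 2 + x ^ 2 + y ^ 2 + m * z ^ 2 := by
  rintro ⟨w, x, y, z, h⟩
  rcases eq_or_ne z 0 with rfl | hz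
  · exact Int.sq_add_sq_add_sq_ne_of_emod_thirty_two (a := w) (b := x) (c := y) hn
      (by linear_combination -h)
  rcases eq_or_ne (z ^ 2) 1 with hz1 | hz1
  · rw [hz1] at h
    exact Int.sq_add_sq_add_sq_ne_of_emod_eight (n := n - m) (a := w) (b := x) (c := y)
      (by omega) (by linear_combination -h)
  have hz4 : 4 ≤ z ^ 2 := by
    have hlt : 1 < |z| := by
      refine lt_of_le_of_ne (Int.one_le_abs hz) fun h1 => hz1 ?_
      rw [← sq_abs, ← h1, one_pow]
    nlinarith [sq_abs z]
  nlinarith [sq_nonneg w, sq_nonneg x, sq_nonneg y]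

theorem Nat.exists_fermatNumber_eq (i : ℕ) :
    ∃ d : ℕ, 0 < d ∧ Nat.fermatNumber (i + 2) = 16 * d ^ 4 + 1 := by
  obtain ⟨d, hd⟩ : 2 ∣ 2 ^ 2 ^ i := dvd_pow_self 2 (by positivity)
  have h2 : 0 < 2 ^ 2 ^ i := by positivity
  refine ⟨d, by omega, ?_⟩
  have : 2 ^ 2 ^ (i + 2) = (2 ^ 2 ^ i) ^ 4 := by rw [← pow_mul, pow_add]; rfl
  rw [Nat.fermatNumber, this, hd]
  ring

/-- A product of two coprime numbers of the form `a ^ 2 + 1` with `a ≠ 0` is not a square. -/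
theorem Nat.not_isSquare_mul_of_coprime {a n : ℕ} (ha : a ≠ 0) (h : Nat.Coprime (a ^ 2 + 1) n) :
    ¬ IsSquare ((a ^ 2 + 1) * n) := by
  rintro ⟨r, hr⟩
  obtain ⟨s, hs⟩ := exists_eq_pow_of_mul_eq_pow (Nat.isUnit_iff.mpr h)
    (hr.trans (pow_two r).symm)
  have h1 : a < s := by nlinarith
  have : 0 < a := Nat.pos_of_ne_zero ha
  nlinarith

/-- The multiplicativity of `x² + 2y²` spreads the representation of `156 - 45 * ω ^ 2`. -/
theorem eq_sq_add_sq_add_sq_add_mul_sq {ω : ℝ} (hω : ω ^ 3 + ω ^ 2 - 2 * ω - 1 = 0) (u v : ℤ) :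
    ∃ w x y z : ℝ, w ∈ Algebra.adjoin ℤ {ω} ∧ x ∈ Algebra.adjoin ℤ {ω} ∧
      y ∈ Algebra.adjoin ℤ {ω} ∧ z ∈ Algebra.adjoin ℤ {ω} ∧
      156 * ((u : ℝ) ^ 2 + 2 * v ^ 2)
        = w ^ 2 + x ^ 2 + y ^ 2 + 45 * ((u : ℝ) ^ 2 + 2 * v ^ 2) * z ^ 2 := by
  have hmem : ω ∈ Algebra.adjoin ℤ {ω} := Algebra.self_mem_adjoin_singleton ℤ ω
  have quad (a b c : ℤ) : (a : ℝ) + b * ω + c * ω ^ 2 ∈ Algebra.adjoin ℤ {ω} :=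
    add_mem (add_mem (intCast_mem _ a) (mul_mem (intCast_mem _ b) hmem))
      (mul_mem (intCast_mem _ c) (pow_mem hmem 2))
  have hα := quad (-6) 1 2
  have hβ := quad (-6) 5 4
  have hx := sub_mem (mul_mem hα (intCast_mem _ v)) (mul_mem hβ (intCast_mem _ u))
  refine ⟨_, _, _, ω, add_mem (mul_mem hα (intCast_mem _ u))
    (mul_mem (mul_mem (intCast_mem _ 2) hβ) (intCast_mem _ v)), hx, hx, hmem, ?_⟩
  push_cast
  linear_combination (-(36 * ω + 48) * ((u : ℝ) ^ 2 + 2 * v ^ 2)) * hω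


/-- Let `ω = ζ₇ + ζ₇⁻¹` be a (real) root of `T³ + T² − 2T − 1`, so that
`ℤ[ω]` is the ring of integers of the totally real cubic field `ℚ(ω)` of discriminant 49.
There is an infinite set `T` of integers `k ≥ 4` such that:
(1) for distinct `k, l ∈ T` the diagonal forms `⟨1,1,1,8k+5⟩` and `⟨1,1,1,8l+5⟩` are not
equivalent over `ℚ` (no invertible linear change of variables over `ℚ` transforms one into
the other); and
(2) for every `k ∈ T` there is a positive integer `n` represented by `⟨1,1,1,8k+5⟩` over
`ℤ[ω]` but not over `ℤ`. -/
theorem statement8 (ω : ℝ) (hω : ω ^ 3 + ω ^ 2 - 2 * ω - 1 = 0) :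
    ∃ T : Set ℤ, T.Infinite ∧ (∀ k ∈ T, 4 ≤ k) ∧
      (∀ k ∈ T, ∀ l ∈ T, k ≠ l →
        ¬ ∃ M : Matrix (Fin 4) (Fin 4) ℚ, IsUnit M.det ∧
          ∀ x : Fin 4 → ℚ,
            (M.mulVec x 0) ^ 2 + (M.mulVec x 1) ^ 2 + (M.mulVec x 2) ^ 2 +
                (8 * (k : ℚ) + 5) * (M.mulVec x 3) ^ 2
              = (x 0) ^ 2 + (x 1) ^ 2 + (x 2) ^ 2 + (8 * (l : ℚ) + 5) * (x 3) ^ 2) ∧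
      (∀ k ∈ T, ∃ n : ℤ, 0 < n ∧
        (∃ w x y z : ℝ, w ∈ Algebra.adjoin ℤ {ω} ∧ x ∈ Algebra.adjoin ℤ {ω} ∧
          y ∈ Algebra.adjoin ℤ {ω} ∧ z ∈ Algebra.adjoin ℤ {ω} ∧
          (n : ℝ) = w ^ 2 + x ^ 2 + y ^ 2 + (8 * (k : ℝ) + 5) * z ^ 2) ∧
        ¬ ∃ w x y z : ℤ, n = w ^ 2 + x ^ 2 + y ^ 2 + (8 * k + 5) * z ^ 2) := by
  choose d hd hF using Nat.exists_fermatNumber_eq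
  have hd_inj : Function.Injective d := fun i j hij => by
    have := Nat.fermatNumber_strictMono.injective
      (show Nat.fermatNumber (i + 2) = Nat.fermatNumber (j + 2) by rw [hF, hF, hij])
    omega
  refine ⟨Set.range fun i => 5 + 90 * (d i : ℤ) ^ 4, Set.infinite_range_of_injective ?_, ?_, ?_, ?_⟩
  · intro i j hij
    apply hd_inj
    have : d i ^ 4 = d j ^ 4 := by
      simp only at hij
      zify
      linarith
    exact Nat.pow_left_injective (by norm_num : 4 ≠ 0) this
  · rintro _ ⟨i, rfl⟩
    have : (0 : ℤ) ≤ (d i : ℤ) ^ 4 := by positivity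
    simp only
    omega
  · rintro _ ⟨i, rfl⟩ _ ⟨j, rfl⟩ hij ⟨M, -, hM⟩
    have hne : i + 2 ≠ j + 2 := fun h => hij (by rw [Nat.add_right_cancel h])
    have hcop := Nat.coprime_fermatNumber_fermatNumber hne
    rw [hF, hF, show 16 * d i ^ 4 + 1 = (4 * d i ^ 2) ^ 2 + 1 by ring] at hcop
    have hdi := hd i
    refine Nat.not_isSquare_mul_of_coprime (by positivity) hcop ?_
    have hdet := exists_sq_mul_eq_of_isometry M hM
    push_cast at hdet
    rw [← Rat.isSquare_natCast_iff]
    refine ⟨((4 * d i ^ 2) ^ 2 + 1) * M.det, ?_⟩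
    push_cast
    linear_combination -((4 * (d i : ℚ) ^ 2) ^ 2 + 1) / 45 * hdet
  · rintro _ ⟨i, rfl⟩
    have hdi : (0 : ℤ) < (d i : ℤ) ^ 4 := by
      have := hd i
      positivity
    refine ⟨156 * (16 * (d i : ℤ) ^ 4 + 1), by omega, ?_, ?_⟩
    · obtain ⟨w, x, y, z, hw, hx, hy, hz, h⟩ :=
        eq_sq_add_sq_add_sq_add_mul_sq hω (4 * (d i : ℤ) ^ 2 - 1) (2 * (d i : ℤ))
      refine ⟨w, x, y, z, hw, hx, hy, hz, ?_⟩
      push_cast at h ⊢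
      linear_combination h
    · simp only
      exact Int.not_exists_sq_add_sq_add_sq_add_mul_sq (by omega) (by omega) (by omega) (by omega)
end

section
/- Let ω = ζ₇ + ζ₇⁻¹, a root of T³ + T² − 2T − 1. For every integer D ≥ 4 there exist infinitely many positive definite quadratic forms of rank D over ℤ, pairwise non-equivalent over ℚ, each of which represents some positive integer over ℤ[ω] that it does not represent over ℤ. -/
open MvPolynomial

namespace TernaryExtension

/-- The coefficients of the squares in `form k p`. -/
def weight (k p : ℕ) : Fin (k + 4) → ℤ :=
  Fin.cons 1 (Fin.cons 2 (Fin.cons 4 (Fin.cons (p : ℤ) fun _ => 14)))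

/-- The form `x₀² + 2x₁² + 4x₂² - x₀x₂ + p x₃² + 14 (x₄² + ⋯)` in `k + 4` variables. -/
noncomputable def form (k p : ℕ) : MvPolynomial (Fin (k + 4)) ℤ :=
  ∑ i, C (weight k p i) * X i ^ 2 - X 0 * X 2

/-- The Gram matrix over `ℚ` of twice `form k p`. -/
def gram (k p : ℕ) : Matrix (Fin (k + 4)) (Fin (k + 4)) ℚ :=
  Matrix.diagonal (fun i => 2 * (weight k p i : ℚ)) - Matrix.single 0 2 1 - Matrix.single 2 0 1

variable {k p : ℕ}

theorem sum_weight {R : Type*} [CommRing R] (x : Fin (k + 4) → R) :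
    ∑ i, (weight k p i : R) * x i ^ 2 = x 0 ^ 2 + 2 * x 1 ^ 2 + 4 * x 2 ^ 2 + p * x 3 ^ 2
      + 14 * ∑ i : Fin k, x i.succ.succ.succ.succ ^ 2 := by
  have h1 : (Fin.succ 0 : Fin (k + 4)) = 1 := rfl
  have h2 : (Fin.succ (Fin.succ 0) : Fin (k + 4)) = 2 := rfl
  have h3 : (Fin.succ (Fin.succ (Fin.succ 0)) : Fin (k + 4)) = 3 := rfl
  rw [Fin.sum_univ_succ, Fin.sum_univ_succ, Fin.sum_univ_succ, Fin.sum_univ_succ, h1, h2, h3,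
    Finset.mul_sum]
  simp only [← h1, ← h2, ← h3, weight, Fin.cons_zero, Fin.cons_succ]
  push_cast
  ring

theorem eval₂_form {R : Type*} [CommRing R] (x : Fin (k + 4) → R) :
    eval₂ (Int.castRingHom R) x (form k p) =
      x 0 ^ 2 + 2 * x 1 ^ 2 + 4 * x 2 ^ 2 - x 0 * x 2 + p * x 3 ^ 2
        + 14 * ∑ i : Fin k, x i.succ.succ.succ.succ ^ 2 := by
  have h := sum_weight (p := p) x
  simp only [form, eval₂_sub, eval₂_sum, eval₂_mul, eval₂_C, eval₂_pow, eval₂_X]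
  simp only [eq_intCast, h]
  ring

theorem eval_form (x : Fin (k + 4) → ℤ) :
    eval x (form k p) =
      x 0 ^ 2 + 2 * x 1 ^ 2 + 4 * x 2 ^ 2 - x 0 * x 2 + p * x 3 ^ 2
        + 14 * ∑ i : Fin k, x i.succ.succ.succ.succ ^ 2 := by
  have h := eval₂_form (p := p) x
  rwa [RingHom.ext_int (Int.castRingHom ℤ) (RingHom.id ℤ)] at h

theorem isHomogeneous_form : (form k p).IsHomogeneous 2 := by
  refine .sub (.sum _ _ _ fun i _ => ?_) ?_
  · simpa using (isHomogeneous_C _ (weight k p i)).mul ((isHomogeneous_X ℤ i).pow 2)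
  · exact (isHomogeneous_X ℤ 0).mul (isHomogeneous_X ℤ 2)

theorem eval₂_form_pos {R : Type*} [CommRing R] [LinearOrder R] [IsStrictOrderedRing R]
    (hp : 0 < p) {x : Fin (k + 4) → R} (hx : x ≠ 0) :
    0 < eval₂ (Int.castRingHom R) x (form k p) := by
  rw [eval₂_form]
  have hp' : (1 : R) ≤ p := by exact_mod_cast hp
  have hS : 0 ≤ ∑ i : Fin k, x i.succ.succ.succ.succ ^ 2 :=
    Finset.sum_nonneg fun i _ => sq_nonneg _
  set S := ∑ i : Fin k, x i.succ.succ.succ.succ ^ 2 with hS_def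
  have h3 : x 3 ^ 2 ≤ p * x 3 ^ 2 := le_mul_of_one_le_left (sq_nonneg _) hp'
  by_contra! hle
  refine hx ?_
  have sq_zero {y : R} (hy : y ^ 2 ≤ 0) : y = 0 := pow_eq_zero_iff two_ne_zero |>.1
    (le_antisymm hy (sq_nonneg y))
  have e0 := sq_nonneg (2 * x 0 - x 2)
  have e1 := sq_nonneg (x 1)
  have e2 := sq_nonneg (x 2)
  have e3 := sq_nonneg (x 3)
  have z2 : x 2 = 0 := sq_zero (by nlinarith)
  have z1 : x 1 = 0 := sq_zero (by nlinarith)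
  have z3 : x 3 = 0 := sq_zero (by nlinarith)
  have z0 : x 0 = 0 := sq_zero (by rw [z2] at hle; nlinarith)
  have zS : S = 0 := le_antisymm (by nlinarith) hS
  have zi := (Finset.sum_eq_zero_iff_of_nonneg fun i _ => sq_nonneg _).1 (hS_def.symm.trans zS)
  funext i
  refine Fin.cases z0 (fun i => Fin.cases z1 (fun i => Fin.cases z2 (fun i => Fin.cases z3
    (fun i => ?_) i) i) i) i
  exact pow_eq_zero_iff two_ne_zero |>.1 (zi i (Finset.mem_univ i))

theorem not_exists_eval_form_eq (hp : 13 < p) :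
    ¬ ∃ x : Fin (k + 4) → ℤ, eval x (form k p) = 13 := by
  rintro ⟨x, hx⟩
  rw [eval_form] at hx
  have hS : 0 ≤ ∑ i : Fin k, x i.succ.succ.succ.succ ^ 2 :=
    Finset.sum_nonneg fun i _ => sq_nonneg _
  generalize ∑ i : Fin k, x i.succ.succ.succ.succ ^ 2 = S at hx hS
  generalize x 0 = a at hx
  generalize x 1 = b at hx
  generalize x 2 = c at hx
  generalize x 3 = d at hx
  have hp' : (14 : ℤ) ≤ p := by exact_mod_cast hp
  have hd : 14 * d ^ 2 ≤ p * d ^ 2 := mul_le_mul_of_nonneg_right hp' (sq_nonneg d)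
  have hd0 : d ^ 2 = 0 := by
    nlinarith [sq_nonneg (2 * a - c), sq_nonneg b, sq_nonneg c, sq_nonneg d]
  have hS0 : S = 0 := by nlinarith [sq_nonneg (2 * a - c), sq_nonneg b, sq_nonneg c]
  rw [hd0, hS0] at hx
  have hc : c ^ 2 ≤ 3 := by nlinarith [sq_nonneg (2 * a - c), sq_nonneg b]
  have hb : b ^ 2 ≤ 6 := by nlinarith [sq_nonneg (2 * a - c), sq_nonneg c]
  have ha : a ^ 2 ≤ 13 := by nlinarith [sq_nonneg (a - 8 * c), sq_nonneg b]
  have hc1 : -1 ≤ c := by nlinarith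
  have hc2 : c ≤ 1 := by nlinarith
  have hb1 : -2 ≤ b := by nlinarith
  have hb2 : b ≤ 2 := by nlinarith
  have ha1 : -3 ≤ a := by nlinarith
  have ha2 : a ≤ 3 := by nlinarith
  interval_cases c <;> interval_cases b <;> interval_cases a <;> omega

theorem exists_eval₂_form_eq {ω : ℝ} (hω : ω ^ 3 + ω ^ 2 - 2 * ω - 1 = 0) :
    ∃ x : Fin (k + 4) → ℝ, (∀ i, x i ∈ Algebra.adjoin ℤ {ω}) ∧
      eval₂ (Int.castRingHom ℝ) x (form k p) = 13 := by
  have hmem : ω ∈ Algebra.adjoin ℤ {ω} := Algebra.self_mem_adjoin_singleton ℤ ω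
  have hone := one_mem (Algebra.adjoin ℤ {ω})
  have hsq := pow_mem hmem 2
  let x : Fin (k + 4) → ℝ :=
    Fin.cons (1 + 1 - ω ^ 2) (Fin.cons (1 - ω ^ 2) (Fin.cons (ω - 1 + ω ^ 2) fun _ => 0))
  refine ⟨x, fun i => ?_, ?_⟩
  · refine Fin.cases ?_ (fun i => Fin.cases ?_ (fun i => Fin.cases ?_ (fun i => ?_) i) i) i
    · exact sub_mem (add_mem hone hone) hsq
    · exact sub_mem hone hsq
    · exact add_mem (sub_mem hmem hone) hsq
    · exact zero_mem _
  · have h0 : x 0 = 1 + 1 - ω ^ 2 := rfl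
    have h1 : x 1 = 1 - ω ^ 2 := rfl
    have h2 : x 2 = ω - 1 + ω ^ 2 := rfl
    have h3 : x 3 = 0 := rfl
    have h4 (i : Fin k) : x i.succ.succ.succ.succ = 0 := rfl
    rw [eval₂_form, h0, h1, h2, h3]
    simp only [h4, ne_eq, OfNat.ofNat_ne_zero, not_false_eq_true, zero_pow,
      Finset.sum_const_zero]
    linear_combination (8 * ω + 1) * hω

theorem isSymm_gram : (gram k p).IsSymm := by
  simp only [Matrix.IsSymm, gram, Matrix.transpose_sub, Matrix.diagonal_transpose,
    Matrix.transpose_single]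
  abel

theorem dotProduct_gram_mulVec (x : Fin (k + 4) → ℚ) :
    x ⬝ᵥ (gram k p).mulVec x = 2 * eval₂ (Int.castRingHom ℚ) x (form k p) := by
  have h : x ⬝ᵥ (Matrix.diagonal fun i => 2 * (weight k p i : ℚ)).mulVec x =
      2 * ∑ i, (weight k p i : ℚ) * x i ^ 2 := by
    simp only [dotProduct, Matrix.mulVec_diagonal, Finset.mul_sum]
    exact Finset.sum_congr rfl fun i _ => by ring
  rw [gram, Matrix.sub_mulVec, Matrix.sub_mulVec, dotProduct_sub, dotProduct_sub, h, sum_weight,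
    eval₂_form]
  simp only [Matrix.single_mulVec]
  simp [dotProduct, Function.update_apply]
  ring

theorem det_gram_ne_zero (hp : 0 < p) : (gram k p).det ≠ 0 := by
  intro h
  obtain ⟨v, hv, hv'⟩ := Matrix.exists_mulVec_eq_zero_iff.2 h
  have h1 := dotProduct_gram_mulVec (p := p) v
  have h2 := eval₂_form_pos hp hv
  rw [hv', dotProduct_zero] at h1
  linarith

theorem det_gram : (gram k p).det = p * (gram k 1).det := by
  have h : gram k p = Matrix.diagonal (Function.update 1 3 (p : ℚ)) * gram k 1 := by
    ext i j
    rw [Matrix.diagonal_mul]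
    by_cases hi : i = 3
    · subst hi
      have h0 : (0 : Fin (k + 4)) ≠ 3 := (Fin.succ_ne_zero (Fin.succ (Fin.succ 0))).symm
      have h2 : (2 : Fin (k + 4)) ≠ 3 := fun h => (Fin.succ_ne_zero (0 : Fin (k + 1))).symm
        (Fin.succ_injective _ (Fin.succ_injective _ h))
      have hw (p : ℕ) : weight k p 3 = p := rfl
      by_cases hj : j = 3
      · subst hj
        simp [gram, hw, h0, h2, mul_comm]
      · simp [gram, Ne.symm hj, h0, h2]
    · rw [Function.update_of_ne hi, Pi.one_apply, one_mul]
      have hw : weight k p i = weight k 1 i := by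
        revert hi
        refine Fin.cases (fun _ => rfl) (fun i => Fin.cases (fun _ => rfl) (fun i => Fin.cases
          (fun _ => rfl) (fun i => Fin.cases (fun h => (h rfl).elim) (fun _ _ => rfl) i) i) i) i
      simp only [gram, Matrix.sub_apply, Matrix.diagonal_apply, hw]
  rw [h, Matrix.det_mul, Matrix.det_diagonal, Finset.prod_update_of_mem (Finset.mem_univ _)]
  simp

theorem eq_of_dotProduct_mulVec_eq {n : Type*} [Fintype n] [DecidableEq n] {A B : Matrix n n ℚ}
    (hA : A.IsSymm) (hB : B.IsSymm) (h : ∀ x, x ⬝ᵥ A.mulVec x = x ⬝ᵥ B.mulVec x) : A = B := by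
  ext i j
  have hi := h (Pi.single i 1)
  have hj := h (Pi.single j 1)
  have hij := h (Pi.single i 1 + Pi.single j 1)
  have hA' := hA.apply i j
  have hB' := hB.apply i j
  simp [Matrix.mulVec_add] at hi hj hij
  linarith

theorem not_isSquare_mul {p q : ℕ} (hp : p.Prime) (hq : q.Prime) (hpq : p ≠ q) :
    ¬ IsSquare ((p : ℚ) * q) := by
  rw [← Nat.cast_mul, Rat.isSquare_natCast_iff]
  rintro ⟨r, hr⟩
  have hpr : p ∣ r := or_self_iff.1 (hp.dvd_mul.1 ⟨q, hr.symm⟩)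
  obtain ⟨s, rfl⟩ := hpr
  have : q = p * (s * s) := Nat.eq_of_mul_eq_mul_left hp.pos (by rw [hr]; ring)
  exact hpq ((Nat.prime_dvd_prime_iff_eq hp hq).1 ⟨_, this⟩)

theorem not_equivalent {p q : ℕ} (hp : p.Prime) (hq : q.Prime) (hpq : p ≠ q) :
    ¬ ∃ M : Matrix (Fin (k + 4)) (Fin (k + 4)) ℚ, ∀ x : Fin (k + 4) → ℚ,
      eval₂ (Int.castRingHom ℚ) (M.mulVec x) (form k p) =
        eval₂ (Int.castRingHom ℚ) x (form k q) := by
  rintro ⟨M, hM⟩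
  have h : M.transpose * gram k p * M = gram k q := by
    refine eq_of_dotProduct_mulVec_eq ?_ isSymm_gram fun x => ?_
    · simp only [Matrix.IsSymm, Matrix.transpose_mul, Matrix.transpose_transpose,
        isSymm_gram.eq, Matrix.mul_assoc]
    · rw [dotProduct_gram_mulVec, ← hM, ← dotProduct_gram_mulVec, ← Matrix.mulVec_mulVec,
        ← Matrix.mulVec_mulVec, Matrix.dotProduct_mulVec, Matrix.vecMul_transpose]
  have hdet := congrArg Matrix.det h
  rw [Matrix.det_mul, Matrix.det_mul, Matrix.det_transpose, det_gram (p := p),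
    det_gram (p := q)] at hdet
  have hq' : (q : ℚ) = p * M.det ^ 2 :=
    mul_right_cancel₀ (det_gram_ne_zero (k := k) one_pos) (by rw [← hdet]; ring)
  exact not_isSquare_mul hp hq hpq ⟨p * M.det, by rw [hq']; ring⟩

theorem form_injective (k : ℕ) : Function.Injective (form k) := by
  intro p q h
  have h' := congrArg (eval (Pi.single 3 1)) h
  rw [eval_form, eval_form] at h'
  simpa using h'

end TernaryExtension

open TernaryExtension in
/-- Let `ω = ζ₇ + ζ₇⁻¹` be a (real) root of `T³ + T² − 2T − 1`, so that
`ℤ[ω]` is the ring of integers of the totally real cubic field `ℚ(ω)` of discriminant 49.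
For every integer `D ≥ 4` there are infinitely many positive definite quadratic forms of
rank `D` over `ℤ` (homogeneous degree-2 polynomials in `D` variables), pairwise non-equivalent
over `ℚ`, each of which represents some positive integer over `ℤ[ω]` that it does not
represent over `ℤ`. -/
theorem statement9 (ω : ℝ) (hω : ω ^ 3 + ω ^ 2 - 2 * ω - 1 = 0)
    (D : ℕ) (hD : 4 ≤ D) :
    ∃ F : Set (MvPolynomial (Fin D) ℤ), F.Infinite ∧
      (∀ Q ∈ F, Q.IsHomogeneous 2 ∧
        (∀ v : Fin D → ℤ, v ≠ 0 → 0 < eval v Q) ∧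
        (∃ n : ℤ, 0 < n ∧
          (∃ x : Fin D → ℝ, (∀ i, x i ∈ Algebra.adjoin ℤ {ω}) ∧
            eval₂ (Int.castRingHom ℝ) x Q = (n : ℝ)) ∧
          ¬ ∃ x : Fin D → ℤ, eval x Q = n)) ∧
      (∀ Q₁ ∈ F, ∀ Q₂ ∈ F, Q₁ ≠ Q₂ →
        ¬ ∃ M : Matrix (Fin D) (Fin D) ℚ, IsUnit M.det ∧
          ∀ x : Fin D → ℚ,
            eval₂ (Int.castRingHom ℚ) (M.mulVec x) Q₁ = eval₂ (Int.castRingHom ℚ) x Q₂) := by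
  obtain ⟨k, rfl⟩ := Nat.exists_eq_add_of_le' hD
  refine ⟨form k '' {p | p.Prime ∧ 13 < p}, ?_, ?_, ?_⟩
  · refine Set.Infinite.image (form_injective k).injOn (Set.infinite_of_not_bddAbove ?_)
    rintro ⟨N, hN⟩
    obtain ⟨p, hp, hp'⟩ := Nat.exists_infinite_primes (N + 14)
    have := hN ⟨hp', by omega⟩
    omega
  · rintro _ ⟨p, ⟨-, hp⟩, rfl⟩
    refine ⟨isHomogeneous_form, fun v hv => ?_, 13, by norm_num, ?_, not_exists_eval_form_eq hp⟩
    · rw [eval_form, ← eval₂_form]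
      exact eval₂_form_pos (by omega) hv
    · simpa using exists_eval₂_form_eq hω
  · rintro _ ⟨p, ⟨hp, -⟩, rfl⟩ _ ⟨q, ⟨hq, -⟩, rfl⟩ hne ⟨M, -, hM⟩
    exact not_equivalent hp hq (fun h => hne (h ▸ rfl)) ⟨M, hM⟩
end

section
/- Let L be a totally real number field of odd degree over ℚ such that there exist α, β ∈ 𝓞_L with α² + 71β² = 232, and such that no proper subfield of L contains such a solution (i.e. for every proper subfield L′ of L there are no α, β ∈ 𝓞_{L′} with α² + 71β² = 232). Then L is isomorphic to the totally real cubic field ℚ(ω), where ω = ζ₇ + ζ₇⁻¹ is a root of T³ + T² − 2T − 1. -/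
open NumberField

open Polynomial IntermediateField in
/-- If every conjugate of `ζ + ζ⁻¹` is real and lies strictly between `-2` and `2`, then the
algebraic integer `ζ` is a root of unity. -/
theorem exists_pow_eq_one_of_conj_add_inv {ζ : ℂ} (hint : IsIntegral ℤ ζ) (h0 : ζ ≠ 0)
    (h : ∀ c : ℂ, aeval c (minpoly ℚ (ζ + ζ⁻¹)) = 0 → c.im = 0 ∧ c.re ^ 2 < 4) :
    ∃ n, 0 < n ∧ ζ ^ n = 1 := by
  have norm_eq_one : ∀ x : ℂ, x ≠ 0 → (x + x⁻¹).im = 0 → (x + x⁻¹).re ^ 2 < 4 → ‖x‖ = 1 := by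
    intro x hx him hre
    obtain ⟨c, hc⟩ : ∃ c : ℝ, x + x⁻¹ = c := ⟨_, (Complex.ext rfl (by simpa using him))⟩
    rw [hc, Complex.ofReal_re] at hre
    have hq : x ^ 2 - c * x + 1 = 0 := by rw [← hc]; field_simp; ring
    have h1 := congrArg Complex.re hq
    have h2 := congrArg Complex.im hq
    simp [pow_two] at h1 h2
    have h3 : x.im * (2 * x.re - c) = 0 := by linarith
    have h4 : x.re * x.re + x.im * x.im = 1 := by
      rcases mul_eq_zero.mp h3 with h | h
      · rw [h] at h1
        nlinarith [sq_nonneg (2 * x.re - c)]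
      · have : c = 2 * x.re := by linarith
        subst this
        linarith
    rw [← sq_eq_sq₀ (norm_nonneg _) zero_le_one, ← Complex.normSq_eq_norm_sq,
      Complex.normSq_apply, h4, one_pow]
  have hintQ : IsIntegral ℚ ζ := hint.tower_top
  have : FiniteDimensional ℚ ℚ⟮ζ⟯ := adjoin.finiteDimensional hintQ
  have : NumberField ℚ⟮ζ⟯ := ⟨⟩
  set g := AdjoinSimple.gen ℚ ζ with hg
  have hgζ : algebraMap ℚ⟮ζ⟯ ℂ g = ζ := AdjoinSimple.algebraMap_gen ℚ ζ
  have hmin : minpoly ℚ (ζ + ζ⁻¹) = minpoly ℚ (g + g⁻¹) := by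
    rw [← minpoly.algebraMap_eq (algebraMap ℚ⟮ζ⟯ ℂ).injective (g + g⁻¹), map_add, map_inv₀, hgζ]
  have hgi : IsIntegral ℤ g := by
    rw [← isIntegral_algebraMap_iff (algebraMap ℚ⟮ζ⟯ ℂ).injective, hgζ]
    exact hint
  have hg0 : g ≠ 0 := by
    intro h
    rw [h, map_zero] at hgζ
    exact h0 hgζ.symm
  obtain ⟨n, hn, hp⟩ := NumberField.Embeddings.pow_eq_one_of_norm_eq_one ℚ⟮ζ⟯ ℂ hgi (fun φ ↦ by
    have key : φ g + (φ g)⁻¹ = φ.toRatAlgHom (g + g⁻¹) := by simp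
    have := h (φ g + (φ g)⁻¹) (by
      rw [hmin, key, aeval_algHom_apply, minpoly.aeval, map_zero])
    exact norm_eq_one _ (by simpa using hg0) this.1 this.2)
  exact ⟨n, hn, by rw [← hgζ, ← map_pow, hp, map_one]⟩

open Polynomial IntermediateField in
/-- For primitive `n`-th roots of unity `ζ` and `z`, the numbers `ζ + ζ⁻¹` and `z + z⁻¹` are
conjugate over `ℚ`. -/
theorem IsPrimitiveRoot.aeval_add_inv_minpoly_eq_zero {ζ z : ℂ} {n : ℕ} (hn : 0 < n)
    (hζ : IsPrimitiveRoot ζ n) (hz : IsPrimitiveRoot z n) :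
    aeval (z + z⁻¹) (minpoly ℚ (ζ + ζ⁻¹)) = 0 := by
  have hint : IsIntegral ℚ ζ := (hζ.isIntegral hn).tower_top
  have hmem : z ∈ (minpoly ℚ ζ).aroots ℂ := by
    rw [mem_aroots, ← cyclotomic_eq_minpoly_rat hζ hn, cyclotomic_eq_minpoly_rat hz hn]
    exact ⟨minpoly.ne_zero (hz.isIntegral hn).tower_top, minpoly.aeval _ _⟩
  set g := AdjoinSimple.gen ℚ ζ
  have hgζ : algebraMap ℚ⟮ζ⟯ ℂ g = ζ := AdjoinSimple.algebraMap_gen ℚ ζ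
  have hmin : minpoly ℚ (ζ + ζ⁻¹) = minpoly ℚ (g + g⁻¹) := by
    rw [← minpoly.algebraMap_eq (algebraMap ℚ⟮ζ⟯ ℂ).injective (g + g⁻¹), map_add, map_inv₀, hgζ]
  set φ := (algHomAdjoinIntegralEquiv ℚ hint).symm ⟨z, hmem⟩
  have hφ : φ g = z := algHomAdjoinIntegralEquiv_symm_apply_gen ℚ hint ⟨z, hmem⟩
  have : z + z⁻¹ = φ (g + g⁻¹) := by rw [map_add, map_inv₀, hφ]
  rw [hmin, this, aeval_algHom_apply, minpoly.aeval, map_zero]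

/-- If all conjugates of `ζ + ζ⁻¹` are at most `√(232 / 71)` in absolute value, where `ζ` is a
primitive `n`-th root of unity with `n` even, then `n ≤ 14`. -/
theorem IsPrimitiveRoot.le_fourteen_of_conj_add_inv {ζ : ℂ} {n : ℕ} (hn : 0 < n) (heven : Even n)
    (hζ : IsPrimitiveRoot ζ n)
    (h : ∀ c : ℂ, Polynomial.aeval c (minpoly ℚ (ζ + ζ⁻¹)) = 0 → 71 * c.re ^ 2 ≤ 232) :
    n ≤ 14 := by
  by_contra! hlt
  have hn16 : 16 ≤ n := by
    obtain ⟨k, rfl⟩ := heven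
    omega
  have hb := h _ (hζ.aeval_add_inv_minpoly_eq_zero hn (Complex.isPrimitiveRoot_exp n hn.ne'))
  have hz : Complex.exp (2 * Real.pi * Complex.I / n) +
      (Complex.exp (2 * Real.pi * Complex.I / n))⁻¹ =
        ((2 * Real.cos (2 * Real.pi / n) : ℝ) : ℂ) := by
    push_cast
    rw [Complex.two_cos, ← Complex.exp_neg]
    congr 2 <;> ring
  rw [hz, Complex.ofReal_re] at hb
  have hcos : Real.cos (Real.pi / 8) ≤ Real.cos (2 * Real.pi / n) := by
    have hnR : (16 : ℝ) ≤ n := by exact_mod_cast hn16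
    apply Real.cos_le_cos_of_nonneg_of_le_pi
    · positivity
    · linarith [Real.pi_pos]
    · rw [div_le_div_iff₀ (by positivity) (by norm_num)]
      nlinarith [Real.pi_pos]
  rw [Real.cos_pi_div_eight] at hcos
  have h2 : (1.4 : ℝ) ≤ √2 := Real.le_sqrt_of_sq_le (by norm_num)
  have h3 : √(2 + √2) ^ 2 = 2 + √2 := Real.sq_sqrt (by positivity)
  have h4 : 0 ≤ √(2 + √2) := Real.sqrt_nonneg _
  nlinarith

/-- A primitive root of unity of even order `2 * k` satisfies `ζ ^ k = -1`. -/
theorem IsPrimitiveRoot.pow_half_eq_neg_one {R : Type*} [CommRing R] [IsDomain R] {ζ : R} {k : ℕ}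
    (hk : 0 < k) (hζ : IsPrimitiveRoot ζ (2 * k)) : ζ ^ k = -1 :=
  (hζ.pow (by omega) (mul_comm 2 k)).eq_neg_one_of_two_right

/-- The possible values of `ζ + ζ⁻¹` for `ζ` a root of unity of even order at most `14`,
other than `±2`. -/
theorem IsPrimitiveRoot.add_inv_cases {ζ : ℂ} {n : ℕ} (hn : 0 < n) (heven : Even n) (hle : n ≤ 14)
    (hζ : IsPrimitiveRoot ζ n) (hne : (ζ + ζ⁻¹) ^ 2 ≠ 4) :
    (ζ + ζ⁻¹) = 0 ∨ (ζ + ζ⁻¹) ^ 2 = 1 ∨ (ζ + ζ⁻¹) ^ 2 = 2 ∨ (ζ + ζ⁻¹) ^ 2 = 3 ∨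
      (2 * (ζ + ζ⁻¹) - 1) ^ 2 = 5 ∨
      (ζ + ζ⁻¹) ^ 3 - (ζ + ζ⁻¹) ^ 2 - 2 * (ζ + ζ⁻¹) + 1 = 0 := by
  obtain ⟨k, rfl⟩ := heven
  rw [← two_mul] at hζ hle
  have h0 : ζ ≠ 0 := hζ.ne_zero (by omega)
  have hp := hζ.pow_half_eq_neg_one (by omega)
  have hpne : ∀ l, 0 < l → l < 2 * k → ζ ^ l ≠ 1 := fun l h1 h2 ↦
    hζ.pow_ne_one_of_pos_of_lt h1.ne' h2
  have hk : k ≤ 7 := by omega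
  have hk1 : 1 ≤ k := by omega
  interval_cases k
  · exfalso
    apply hne
    rw [pow_one] at hp
    rw [hp]
    norm_num
  · left
    field_simp
    linear_combination hp
  · right; left
    have hne1 : ζ + 1 ≠ 0 := fun h ↦
      hpne 2 (by norm_num) (by norm_num) (by linear_combination (ζ - 1) * h)
    have h : ζ ^ 2 - ζ + 1 = 0 := by
      apply mul_left_cancel₀ hne1
      linear_combination hp
    field_simp
    linear_combination (ζ ^ 2 + ζ + 1) * h
  · right; right; left
    field_simp
    linear_combination hp
  · right; right; right; right; left
    have hne1 : ζ + 1 ≠ 0 := fun h ↦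
      hpne 2 (by norm_num) (by norm_num) (by linear_combination (ζ - 1) * h)
    have h : ζ ^ 4 - ζ ^ 3 + ζ ^ 2 - ζ + 1 = 0 := by
      apply mul_left_cancel₀ hne1
      linear_combination hp
    field_simp
    linear_combination 4 * h
  · right; right; right; left
    have hne1 : ζ ^ 2 + 1 ≠ 0 := fun h ↦
      hpne 4 (by norm_num) (by norm_num) (by linear_combination (ζ ^ 2 - 1) * h)
    have h : ζ ^ 4 - ζ ^ 2 + 1 = 0 := by
      apply mul_left_cancel₀ hne1
      linear_combination hp
    field_simp
    linear_combination h
  · right; right; right; right; right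
    have hne1 : ζ + 1 ≠ 0 := fun h ↦
      hpne 2 (by norm_num) (by norm_num) (by linear_combination (ζ - 1) * h)
    have h : ζ ^ 6 - ζ ^ 5 + ζ ^ 4 - ζ ^ 3 + ζ ^ 2 - ζ + 1 = 0 := by
      apply mul_left_cancel₀ hne1
      linear_combination hp
    field_simp
    linear_combination h

/-- In an extension of odd degree, an element whose square lies in an intermediate field lies
itself in that field. -/
theorem IntermediateField.mem_of_sq_mem_of_odd_finrank {k L : Type*} [Field k] [Field L]
    [Algebra k L] [FiniteDimensional k L] (hodd : Odd (Module.finrank k L))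
    (F : IntermediateField k L) {x : L} (hx : x ^ 2 ∈ F) : x ∈ F := by
  have hoddF : Odd (Module.finrank F L) := by
    rw [← Module.finrank_mul_finrank k F L] at hodd
    exact Nat.Odd.of_mul_right hodd
  have hint : IsIntegral F x := IsIntegral.of_finite F x
  have hdvd : (minpoly F x).natDegree ∣ Module.finrank F L := minpoly.degree_dvd hint
  have hle : (minpoly F x).natDegree ≤ 2 := by
    have hm : (Polynomial.X ^ 2 - Polynomial.C (⟨x ^ 2, hx⟩ : F)).Monic :=
      Polynomial.monic_X_pow_sub_C _ two_ne_zero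
    have := Polynomial.natDegree_le_natDegree (minpoly.min F x hm (by
      simp [IntermediateField.algebraMap_apply]))
    rwa [Polynomial.natDegree_X_pow_sub_C] at this
  have hpos := minpoly.natDegree_pos hint
  have h1 : (minpoly F x).natDegree = 1 := by
    have : Odd (minpoly F x).natDegree := Odd.of_dvd_nat hoddF hdvd
    obtain ⟨j, hj⟩ := this
    omega
  obtain ⟨y, hy⟩ := minpoly.natDegree_eq_one_iff.mp h1
  rw [← hy]
  exact y.2

/-- A natural number that is a square in a number field of odd degree is a perfect square. -/
theorem NumberField.isSquare_of_sq_eq_of_odd_finrank {L : Type*} [Field L] [NumberField L]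
    (hodd : Odd (Module.finrank ℚ L)) {x : L} {m : ℕ} (hx : x ^ 2 = m) : IsSquare m := by
  have hmem : x ∈ (⊥ : IntermediateField ℚ L) :=
    IntermediateField.mem_of_sq_mem_of_odd_finrank hodd ⊥ (by rw [hx]; exact natCast_mem _ m)
  obtain ⟨q, rfl⟩ := IntermediateField.mem_bot.mp hmem
  rw [← map_pow, ← map_natCast (algebraMap ℚ L)] at hx
  have hq : q ^ 2 = m := (algebraMap ℚ L).injective hx
  exact Rat.isSquare_natCast_iff.mp ⟨q, by rw [← hq, sq]⟩

open Polynomial in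
/-- Up to sign, an algebraic integer of a totally real number field all of whose conjugates are at
most `√(232 / 71)` in absolute value is a sum `ζ + ζ⁻¹` for a root of unity `ζ` of even order at
most `14`. -/
theorem NumberField.cases_of_conj_bounded {L : Type*} [Field L] [NumberField L] {β : L}
    (hint : IsIntegral ℤ β) (h : ∀ σ : L →+* ℂ, (σ β).im = 0 ∧ 71 * (σ β).re ^ 2 ≤ 232) :
    ∃ γ : L, γ ^ 2 = β ^ 2 ∧ (γ = 0 ∨ γ ^ 2 = 1 ∨ γ ^ 2 = 2 ∨ γ ^ 2 = 3 ∨ (2 * γ - 1) ^ 2 = 5 ∨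
      γ ^ 3 - γ ^ 2 - 2 * γ + 1 = 0) := by
  obtain ⟨σ⟩ : Nonempty (L →+* ℂ) := inferInstance
  have hconj : ∀ γ : L, γ ^ 2 = β ^ 2 → ∀ c : ℂ, aeval c (minpoly ℚ (σ γ)) = 0 →
      c.im = 0 ∧ 71 * c.re ^ 2 ≤ 232 := by
    intro γ hγ c hc
    have hc' : c ∈ (minpoly ℚ γ).rootSet ℂ := by
      have hm : minpoly ℚ (σ γ) = minpoly ℚ γ :=
        minpoly.algHom_eq σ.toRatAlgHom σ.injective γ
      rw [hm] at hc
      exact mem_rootSet.mpr ⟨minpoly.ne_zero (IsIntegral.of_finite ℚ γ), hc⟩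
    rw [← NumberField.Embeddings.range_eval_eq_rootSet_minpoly] at hc'
    obtain ⟨τ, rfl⟩ := hc'
    rcases sq_eq_sq_iff_eq_or_eq_neg.mp hγ with rfl | rfl
    · exact h τ
    · simpa using h τ
  obtain ⟨ζ, hζ⟩ : ∃ ζ : ℂ, ζ ^ 2 - σ β * ζ + 1 = 0 := by
    obtain ⟨s, hs⟩ := IsAlgClosed.exists_pow_nat_eq (σ β ^ 2 - 4) (n := 2) (by norm_num)
    exact ⟨(σ β + s) / 2, by linear_combination hs / 4⟩
  have h0 : ζ ≠ 0 := by
    rintro rfl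
    simp at hζ
  have hb : ζ + ζ⁻¹ = σ β := by
    field_simp
    linear_combination hζ
  have hζint : IsIntegral ℤ ζ := by
    have hσ : IsIntegral ℤ (σ β) := hint.map (σ.toIntAlgHom)
    apply isIntegral_trans (A := integralClosure ℤ ℂ)
    refine ⟨X ^ 2 - C ⟨σ β, hσ⟩ * X + 1, by monicity!, ?_⟩
    simpa [eval₂_add, eval₂_sub] using hζ
  obtain ⟨m, hm, hpow⟩ := exists_pow_eq_one_of_conj_add_inv hζint h0 (fun c hc ↦ by
    rw [hb] at hc
    have := hconj β rfl c hc
    exact ⟨this.1, by linarith [this.2]⟩)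
  have main : ∀ (γ : L) (ξ : ℂ) (n : ℕ), γ ^ 2 = β ^ 2 → ξ + ξ⁻¹ = σ γ → IsPrimitiveRoot ξ n →
      0 < n → Even n → (γ = 0 ∨ γ ^ 2 = 1 ∨ γ ^ 2 = 2 ∨ γ ^ 2 = 3 ∨ (2 * γ - 1) ^ 2 = 5 ∨
      γ ^ 3 - γ ^ 2 - 2 * γ + 1 = 0) := by
    intro γ ξ n hγ hξ hprim hn heven
    have hle := hprim.le_fourteen_of_conj_add_inv hn heven
      (fun c hc ↦ (hconj γ hγ c (by rwa [← hξ])).2)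
    have hne : (ξ + ξ⁻¹) ^ 2 ≠ 4 := by
      have hs := hconj γ hγ (σ γ) (minpoly.aeval _ _)
      rw [hξ]
      intro h4
      have h5 := congrArg Complex.re h4
      rw [sq, Complex.mul_re, hs.1] at h5
      norm_num at h5
      nlinarith [hs.2]
    have := hprim.add_inv_cases hn heven hle hne
    rw [hξ] at this
    have e : ∀ x y : L, σ x = σ y ↔ x = y := fun x y ↦ σ.injective.eq_iff
    simpa only [← map_ofNat σ, ← map_one σ, ← map_zero σ, ← map_pow, ← map_mul, ← map_sub,
      ← map_add, e] using this
  have hfin : IsOfFinOrder ζ := isOfFinOrder_iff_pow_eq_one.mpr ⟨m, hm, hpow⟩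
  rcases Nat.even_or_odd (orderOf ζ) with he | ho
  · exact ⟨β, rfl, main β ζ _ rfl hb (IsPrimitiveRoot.orderOf ζ) hfin.orderOf_pos he⟩
  · have hord : orderOf (-1 * ζ) = 2 * orderOf ζ := by
      have h2 : orderOf (-1 : ℂ) = 2 := by
        rw [orderOf_neg_one, if_neg]
        simp [ringChar.eq_zero]
      rw [(Commute.all (-1) ζ).orderOf_mul_eq_mul_orderOf_of_coprime, h2]
      rw [h2]
      exact Nat.coprime_two_left.mpr ho
    refine ⟨-β, by ring, main (-β) (-1 * ζ) (2 * orderOf ζ) (by ring) ?_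
      (hord ▸ IsPrimitiveRoot.orderOf _) (by have := hfin.orderOf_pos; omega) (even_two_mul _)⟩
    rw [map_neg, ← hb, mul_inv]
    norm_num
    ring

open Polynomial in
/-- A root of `T³ + T² − 2T − 1` in an extension of `ℚ` has this polynomial as its minimal
polynomial. -/
theorem minpoly_rat_eq_cubic {K : Type*} [Field K] [CharZero K] {x : K}
    (hx : x ^ 3 + x ^ 2 - 2 * x - 1 = 0) :
    minpoly ℚ x = X ^ 3 + X ^ 2 - C 2 * X - 1 := by
  have hmonic : (X ^ 3 + X ^ 2 - C 2 * X - 1 : ℚ[X]).Monic := by monicity!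
  refine (minpoly.eq_of_irreducible_of_monic ?_ (by simpa using hx) hmonic).symm
  have hdeg : (X ^ 3 + X ^ 2 - C 2 * X - 1 : ℚ[X]).natDegree = 3 := by compute_degree!
  apply irreducible_of_degree_le_three_of_not_isRoot
  · rw [hdeg]; decide
  · intro q hq
    have hq' : q ^ 3 + q ^ 2 - 2 * q - 1 = 0 := by simpa using hq
    have hmonicZ : (X ^ 3 + X ^ 2 - C 2 * X - 1 : ℤ[X]).Monic := by monicity!
    obtain ⟨z, rfl⟩ := isInteger_of_is_root_of_monic hmonicZ (r := q) (by simpa [aeval_def] using hq')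
    have hz : z ^ 3 + z ^ 2 - 2 * z - 1 = 0 := by
      simp only [algebraMap_int_eq, eq_intCast] at hq'
      exact_mod_cast hq'
    have hunit : IsUnit z := IsUnit.of_mul_eq_one (z ^ 2 + z - 2) (by linear_combination hz)
    rcases Int.isUnit_iff.mp hunit with rfl | rfl <;> norm_num at hz

theorem statement12
    (L : Type) [Field L] [NumberField L]
    (hTR : ∀ σ : L →+* ℂ, ∀ x : L, (σ x).im = 0)
    (hodd : Odd (Module.finrank ℚ L))
    (hsol : ∃ α β : 𝓞 L, α ^ 2 + 71 * β ^ 2 = 232)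
    (hmin : ∀ L' : Subfield L, L' ≠ ⊤ →
      ¬ ∃ α β : L, α ∈ L' ∧ β ∈ L' ∧ IsIntegral ℤ α ∧ IsIntegral ℤ β ∧
        α ^ 2 + 71 * β ^ 2 = 232) :
    ∀ ω : ℝ, ω ^ 3 + ω ^ 2 - 2 * ω - 1 = 0 →
      Nonempty (L ≃+* (IntermediateField.adjoin ℚ {ω} : IntermediateField ℚ ℝ)) := by
  intro ω hω
  obtain ⟨a, b, hab⟩ := hsol
  obtain ⟨α, hα, hαi⟩ : ∃ α : L, α = a ∧ IsIntegral ℤ α := ⟨_, rfl, a.isIntegral_coe⟩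
  obtain ⟨β, hβ, hβi⟩ : ∃ β : L, β = b ∧ IsIntegral ℤ β := ⟨_, rfl, b.isIntegral_coe⟩
  have heq : α ^ 2 + 71 * β ^ 2 = 232 := by
    rw [hα, hβ]
    simpa [map_ofNat] using congrArg (algebraMap (𝓞 L) L) hab
  have nonsquare : ∀ (x : L) (m : ℕ), ¬ IsSquare m → x ^ 2 ≠ m := fun x m hm hx ↦
    hm (NumberField.isSquare_of_sq_eq_of_odd_finrank hodd hx)
  obtain ⟨γ, hγβ, hcases⟩ := NumberField.cases_of_conj_bounded hβi (fun σ ↦ by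
    refine ⟨hTR σ β, ?_⟩
    have h := congrArg σ heq
    rw [map_add, map_mul, map_pow, map_pow, map_ofNat, map_ofNat] at h
    have h := congrArg Complex.re h
    simp [sq, hTR σ] at h
    nlinarith [sq_nonneg (σ α).re])
  have hcubic : γ ^ 3 - γ ^ 2 - 2 * γ + 1 = 0 := by
    rcases hcases with h | h | h | h | h | h
    · rw [← hγβ, h] at heq
      exact absurd (by simpa using heq) (nonsquare α 232 (by decide +kernel))
    · rw [← hγβ, h] at heq
      exact absurd (by push_cast; linear_combination heq) (nonsquare α 161 (by decide +kernel))
    · exact absurd h (nonsquare γ 2 (by decide +kernel))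
    · exact absurd h (nonsquare γ 3 (by decide +kernel))
    · exact absurd h (nonsquare _ 5 (by decide +kernel))
    · exact h
  set δ := -γ with hδ
  have hδcubic : δ ^ 3 + δ ^ 2 - 2 * δ - 1 = 0 := by linear_combination -hcubic
  have hδβ : δ ^ 2 = β ^ 2 := by rw [← hγβ, hδ]; ring
  set F : IntermediateField ℚ L := IntermediateField.adjoin ℚ {δ}
  have hδF : δ ∈ F := IntermediateField.mem_adjoin_simple_self ℚ δ
  have hβF : β ∈ F := IntermediateField.mem_of_sq_mem_of_odd_finrank hodd F
    (hδβ ▸ pow_mem hδF 2)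
  have hαF : α ∈ F := IntermediateField.mem_of_sq_mem_of_odd_finrank hodd F (by
    rw [eq_sub_of_add_eq heq]
    exact sub_mem (ofNat_mem F 232) (mul_mem (ofNat_mem F 71) (pow_mem hβF 2)))
  have htop : F = ⊤ := by
    by_contra hne
    refine hmin F.toSubfield (fun h ↦ hne ?_) ⟨α, β, hαF, hβF, hαi, hβi, heq⟩
    exact IntermediateField.toSubfield_injective (h.trans IntermediateField.top_toSubfield.symm)
  have hpoly : minpoly ℚ δ = minpoly ℚ ω := by
    rw [minpoly_rat_eq_cubic hδcubic, minpoly_rat_eq_cubic hω]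
  have hωi : IsIntegral ℚ ω := by
    rw [← minpoly.ne_zero_iff, ← hpoly]
    exact minpoly.ne_zero (IsIntegral.of_finite ℚ δ)
  exact ⟨((IntermediateField.topEquiv.symm.trans (IntermediateField.equivOfEq htop.symm)).trans
    ((IntermediateField.adjoinRootEquivAdjoin ℚ (IsIntegral.of_finite ℚ δ)).symm.trans
      ((AdjoinRoot.algEquivOfEq _ _ _ hpoly).trans
        (IntermediateField.adjoinRootEquivAdjoin ℚ hωi)))).toRingEquiv⟩
end

section
/- Let K = ℚ(√21) with ring of integers 𝓞_K = ℤ[(1+√21)/2], and let θ = ζ₂₁ + ζ₂₁⁻¹, so that L = ℚ(θ) is a totally real field of degree 6 containing K (indeed √21 = 2θ⁵ + 2θ⁴ − 10θ³ − 8θ² + 12θ + 3) with ring of integers ℤ[θ]. Then the element a = 7 + ((1+√21)/2)² is not a sum of four squares of elements of 𝓞_K, but a = 1² + (θ − 1)² + (θ² + θ − 2)² + (θ⁵ − θ⁴ − 7θ³ + 5θ² + 12θ − 5)² in ℤ[θ]. -/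
/-- The septuple-angle formula for `2 * cos x`. -/
theorem two_mul_cos_seven_mul (x : ℝ) :
    2 * Real.cos (7 * x) = (2 * Real.cos x) ^ 7 - 7 * (2 * Real.cos x) ^ 5 +
      14 * (2 * Real.cos x) ^ 3 - 7 * (2 * Real.cos x) := by
  have h := Real.two_mul_cos_mul_cos (4 * x) (3 * x)
  rw [show 4 * x - 3 * x = x by ring, show 4 * x + 3 * x = 7 * x by ring, Real.cos_three_mul,
    show 4 * x = 2 * (2 * x) by ring, Real.cos_two_mul (2 * x), Real.cos_two_mul x] at h
  linear_combination -2 * h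

theorem nineteen_tenths_lt_two_mul_cos : 19 / 10 < 2 * Real.cos (2 * Real.pi / 21) := by
  have h := Real.one_sub_sq_div_two_le_cos (x := 2 * Real.pi / 21)
  nlinarith [Real.pi_lt_d2, Real.pi_pos]

theorem two_mul_cos_two_pi_div_twentyone_root {θ : ℝ}
    (hθ : θ = 2 * Real.cos (2 * Real.pi / 21)) :
    θ ^ 6 - θ ^ 5 - 6 * θ ^ 4 + 6 * θ ^ 3 + 8 * θ ^ 2 - 8 * θ + 1 = 0 := by
  have h := two_mul_cos_seven_mul (2 * Real.pi / 21)
  rw [← hθ, show 7 * (2 * Real.pi / 21) = Real.pi - Real.pi / 3 by ring, Real.cos_pi_sub,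
    Real.cos_pi_div_three] at h
  have hpos : θ + 1 ≠ 0 := by linarith [nineteen_tenths_lt_two_mul_cos]
  refine (mul_eq_zero.mp ?_).resolve_left hpos
  linear_combination -h

theorem sqrt_twentyone_eq {θ : ℝ} (hθ : 19 / 10 < θ)
    (h : θ ^ 6 - θ ^ 5 - 6 * θ ^ 4 + 6 * θ ^ 3 + 8 * θ ^ 2 - 8 * θ + 1 = 0) :
    Real.sqrt 21 = 2 * θ ^ 5 + 2 * θ ^ 4 - 10 * θ ^ 3 - 8 * θ ^ 2 + 12 * θ + 3 := by
  rw [Real.sqrt_eq_iff_mul_self_eq (by norm_num)]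
  · linear_combination (-4 * θ ^ 4 - 12 * θ ^ 3 + 24 * θ + 12) * h
  · obtain ⟨t, rfl⟩ : ∃ t, θ = t + 19 / 10 := ⟨θ - 19 / 10, by ring⟩
    have ht : 0 ≤ t := by linarith
    ring_nf
    positivity

theorem half_one_add_sqrt_twentyone_sq :
    ((1 + Real.sqrt 21) / 2) ^ 2 = (1 + Real.sqrt 21) / 2 + 5 := by
  linear_combination Real.sq_sqrt (show (0 : ℝ) ≤ 21 by norm_num) / 4

theorem exists_int_eq_of_mem_adjoin {ω x : ℝ} (hω : ω ^ 2 = ω + 5)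
    (hx : x ∈ Algebra.adjoin ℤ {ω}) : ∃ p q : ℤ, x = p + q * ω := by
  induction hx using Algebra.adjoin_induction with
  | mem x hx => exact ⟨0, 1, by simpa using hx⟩
  | algebraMap r => exact ⟨r, 0, by simp⟩
  | add x y _ _ hx hy =>
    obtain ⟨p, q, rfl⟩ := hx
    obtain ⟨r, s, rfl⟩ := hy
    exact ⟨p + r, q + s, by push_cast; ring⟩
  | mul x y _ _ hx hy =>
    obtain ⟨p, q, rfl⟩ := hx
    obtain ⟨r, s, rfl⟩ := hy
    exact ⟨p * r + 5 * q * s, p * s + q * r + q * s, by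
      push_cast; linear_combination (q * s : ℝ) * hω⟩

theorem int_eq_of_add_mul_sqrt_twentyone {p q r s : ℤ}
    (h : (p : ℝ) + q * ((1 + Real.sqrt 21) / 2) = r + s * ((1 + Real.sqrt 21) / 2)) :
    p = r ∧ q = s := by
  have hirr : Irrational (Real.sqrt 21) := by
    rw [show (21 : ℝ) = ((21 : ℕ) : ℝ) by norm_num, irrational_sqrt_natCast_iff]
    rintro ⟨n, hn⟩
    have : n < 5 := by nlinarith
    interval_cases n <;> omega
  have hqs : q = s := by
    by_contra hne
    have hne' : q - s ≠ 0 := sub_ne_zero.mpr hne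
    refine ((hirr.intCast_mul hne').ne_int (2 * (r - p) - (q - s))) ?_
    push_cast
    linear_combination 2 * h
  subst hqs
  exact ⟨by exact_mod_cast add_right_cancel h, rfl⟩

/-- Coordinatewise obstruction to writing `12 + ω` as a sum of four squares when
`ω ^ 2 = ω + 5`. -/
theorem not_four_squares_coordinates (p q r s p' q' r' s' : ℤ)
    (h₁ : p ^ 2 + q ^ 2 + r ^ 2 + s ^ 2 + 5 * (p' ^ 2 + q' ^ 2 + r' ^ 2 + s' ^ 2) = 12)
    (h₂ : 2 * (p * p' + q * q' + r * r' + s * s') +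
      (p' ^ 2 + q' ^ 2 + r' ^ 2 + s' ^ 2) = 1) : False := by
  have hsum : p' ^ 2 + q' ^ 2 + r' ^ 2 + s' ^ 2 = 1 := by
    have := sq_nonneg p
    have := sq_nonneg q
    have := sq_nonneg r
    have := sq_nonneg s
    have : 0 ≤ p' ^ 2 + q' ^ 2 + r' ^ 2 + s' ^ 2 := by positivity
    omega
  have hseven (x y z : ℤ) : x ^ 2 + y ^ 2 + z ^ 2 ≠ 7 := by
    intro h
    have h8 := congrArg (Int.cast : ℤ → ZMod 8) h
    push_cast at h8
    generalize (x : ZMod 8) = x at h8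
    generalize (y : ZMod 8) = y at h8
    generalize (z : ZMod 8) = z at h8
    revert x y z
    decide
  have bound (x : ℤ) (hx : x ^ 2 ≤ 1) : x = -1 ∨ x = 0 ∨ x = 1 := by
    have : x ≤ 1 := by nlinarith
    have : -1 ≤ x := by nlinarith
    omega
  have hdot : p * p' + q * q' + r * r' + s * s' = 0 := by omega
  have hp : p ^ 2 + q ^ 2 + r ^ 2 + s ^ 2 = 7 := by omega
  have hp' := bound p' (by nlinarith)
  have hq' := bound q' (by nlinarith)
  have hr' := bound r' (by nlinarith)
  have hs' := bound s' (by nlinarith)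
  have := hseven p q r
  have := hseven p q s
  have := hseven p r s
  have := hseven q r s
  rcases hp' with rfl | rfl | rfl <;> rcases hq' with rfl | rfl | rfl <;>
    rcases hr' with rfl | rfl | rfl <;> rcases hs' with rfl | rfl | rfl <;>
    norm_num at hsum <;> simp_all


/-- Let `K = ℚ(√21)` with ring of integers `ℤ[(1+√21)/2]`, and let
`θ = ζ₂₁ + ζ₂₁⁻¹ = 2 cos(2π/21)`, so that `ℚ(θ)` is the maximal totally real subfield of the
21st cyclotomic field, a degree-6 field containing `K` with ring of integers `ℤ[θ]`.
Then `θ` is a root of `T⁶ − T⁵ − 6T⁴ + 6T³ + 8T² − 8T + 1`, one has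
`√21 = 2θ⁵ + 2θ⁴ − 10θ³ − 8θ² + 12θ + 3` (so `K ⊆ ℚ(θ)`), the element
`a = 7 + ((1+√21)/2)²` is not a sum of four squares of elements of `ℤ[(1+√21)/2]`, yet
`a = 1² + (θ−1)² + (θ²+θ−2)² + (θ⁵−θ⁴−7θ³+5θ²+12θ−5)²` is a sum of four squares in `ℤ[θ]`. -/
theorem statement13 (θ : ℝ) (hθ : θ = 2 * Real.cos (2 * Real.pi / 21)) :
    θ ^ 6 - θ ^ 5 - 6 * θ ^ 4 + 6 * θ ^ 3 + 8 * θ ^ 2 - 8 * θ + 1 = 0 ∧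
    Real.sqrt 21 = 2 * θ ^ 5 + 2 * θ ^ 4 - 10 * θ ^ 3 - 8 * θ ^ 2 + 12 * θ + 3 ∧
    (¬ ∃ w x y z : ℝ,
      w ∈ Algebra.adjoin ℤ {(1 + Real.sqrt 21) / 2} ∧
      x ∈ Algebra.adjoin ℤ {(1 + Real.sqrt 21) / 2} ∧
      y ∈ Algebra.adjoin ℤ {(1 + Real.sqrt 21) / 2} ∧
      z ∈ Algebra.adjoin ℤ {(1 + Real.sqrt 21) / 2} ∧
      7 + ((1 + Real.sqrt 21) / 2) ^ 2 = w ^ 2 + x ^ 2 + y ^ 2 + z ^ 2) ∧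
    7 + ((1 + Real.sqrt 21) / 2) ^ 2 =
      1 ^ 2 + (θ - 1) ^ 2 + (θ ^ 2 + θ - 2) ^ 2 +
        (θ ^ 5 - θ ^ 4 - 7 * θ ^ 3 + 5 * θ ^ 2 + 12 * θ - 5) ^ 2 := by
  have hlt : 19 / 10 < θ := hθ ▸ nineteen_tenths_lt_two_mul_cos
  have hroot := two_mul_cos_two_pi_div_twentyone_root hθ
  have hsqrt := sqrt_twentyone_eq hlt hroot
  refine ⟨hroot, hsqrt, ?_, ?_⟩
  · rintro ⟨w, x, y, z, hw, hx, hy, hz, h⟩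
    have hω := half_one_add_sqrt_twentyone_sq
    obtain ⟨p, p', rfl⟩ := exists_int_eq_of_mem_adjoin hω hw
    obtain ⟨q, q', rfl⟩ := exists_int_eq_of_mem_adjoin hω hx
    obtain ⟨r, r', rfl⟩ := exists_int_eq_of_mem_adjoin hω hy
    obtain ⟨s, s', rfl⟩ := exists_int_eq_of_mem_adjoin hω hz
    obtain ⟨h₁, h₂⟩ := int_eq_of_add_mul_sqrt_twentyone
      (p := p ^ 2 + q ^ 2 + r ^ 2 + s ^ 2 + 5 * (p' ^ 2 + q' ^ 2 + r' ^ 2 + s' ^ 2))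
      (q := 2 * (p * p' + q * q' + r * r' + s * s') + (p' ^ 2 + q' ^ 2 + r' ^ 2 + s' ^ 2))
      (r := 12) (s := 1) (by
        push_cast
        linear_combination -h + (1 - (p' ^ 2 + q' ^ 2 + r' ^ 2 + s' ^ 2 : ℝ)) * hω)
    exact not_four_squares_coordinates p q r s p' q' r' s' h₁ h₂
  · rw [half_one_add_sqrt_twentyone_sq, hsqrt]
    linear_combination (-θ ^ 4 + θ ^ 3 + 8 * θ ^ 2 - 4 * θ - 17) * hroot
end

section
/- Let α = 12 + 2√13. Then α is not a sum of four squares of elements of ℤ[(1+√13)/2], the ring of integers of ℚ(√13), but α is a sum of four squares of elements of ℤ[ζ₁₃ + ζ₁₃⁻¹], the ring of integers of the maximal totally real subfield ℚ(ζ₁₃ + ζ₁₃⁻¹) of the 13th cyclotomic field. -/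
/-- Every element of `ℤ[(1+√13)/2]` has the form `(u + b√13) / 2` with integers
`u ≡ b (mod 2)`. -/
lemma exists_int_of_mem_adjoin {x : ℝ}
    (hx : x ∈ Algebra.adjoin ℤ {(1 + Real.sqrt 13) / 2}) :
    ∃ u b : ℤ, (2 : ℤ) ∣ u - b ∧ x = (u + b * Real.sqrt 13) / 2 := by
  have hs : Real.sqrt 13 ^ 2 = 13 := Real.sq_sqrt (by norm_num)
  induction hx using Algebra.adjoin_induction with
  | mem x hx =>
    rw [Set.mem_singleton_iff] at hx
    exact ⟨1, 1, by norm_num, by rw [hx]; push_cast; ring⟩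
  | algebraMap r => exact ⟨2 * r, 0, by simp, by simp⟩
  | add x y _ _ hx hy =>
    obtain ⟨u, b, h, rfl⟩ := hx
    obtain ⟨v, c, h', rfl⟩ := hy
    exact ⟨u + v, b + c, by omega, by push_cast; ring⟩
  | mul x y _ _ hx hy =>
    obtain ⟨u, b, ⟨k, hk⟩, rfl⟩ := hx
    obtain ⟨v, c, ⟨l, hl⟩, rfl⟩ := hy
    obtain rfl : u = b + 2 * k := by omega
    obtain rfl : v = c + 2 * l := by omega
    refine ⟨7 * b * c + b * l + c * k + 2 * k * l, b * c + b * l + c * k,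
      ⟨3 * b * c + k * l, by ring⟩, ?_⟩
    push_cast
    linear_combination (b * c / 4 : ℝ) * hs

/-- If `a + b√13 = c + d√13` with integers `a, b, c, d`, then the coefficients agree. -/
lemma int_add_mul_sqrt_thirteen_inj {a b c d : ℤ}
    (h : (a : ℝ) + b * Real.sqrt 13 = c + d * Real.sqrt 13) : a = c ∧ b = d := by
  have hirr : Irrational (Real.sqrt 13) := by
    simpa using Nat.Prime.irrational_sqrt (p := 13) (by norm_num)
  have hbd : b = d := by
    by_contra hne
    have hne' : ((b : ℝ) - d) ≠ 0 := by
      rw [sub_ne_zero]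
      exact_mod_cast hne
    refine hirr ⟨(c - a : ℚ) / (b - d), ?_⟩
    push_cast
    rw [div_eq_iff hne']
    linear_combination -h
  subst hbd
  exact ⟨by exact_mod_cast add_right_cancel h, rfl⟩

/-- Two odd integers with sum `4` and two even integers never have squares summing to `22`. -/
lemma sum_sq_ne_twenty_two {p q r s : ℤ} (hp : p % 2 = 1) (hr : r % 2 = 0)
    (hs : s % 2 = 0) (hpq : p + q = 4) : p ^ 2 + q ^ 2 + r ^ 2 + s ^ 2 ≠ 22 := by
  intro h
  obtain ⟨m, rfl⟩ : ∃ m, p = 2 * m + 1 := ⟨p / 2, by omega⟩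
  obtain ⟨k, rfl⟩ : ∃ k, r = 2 * k := ⟨r / 2, by omega⟩
  obtain ⟨l, rfl⟩ : ∃ l, s = 2 * l := ⟨s / 2, by omega⟩
  obtain rfl : q = 3 - 2 * m := by omega
  have h' : 2 * (m * (m - 1)) + k ^ 2 + l ^ 2 = 3 := by linarith
  have hm : m * (m - 1) % 2 = 0 := by
    rcases Int.emod_two_eq_zero_or_one m with e | e <;> simp [Int.mul_emod, Int.sub_emod, e]
  have hsq (n : ℤ) : n ^ 2 % 4 = 0 ∨ n ^ 2 % 4 = 1 := by
    rcases Int.even_or_odd' n with ⟨j, rfl | rfl⟩ <;> ring_nf <;> omega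
  have hk := hsq k
  have hl := hsq l
  omega

/-- The coefficient equations for writing `12 + 2√13` as a sum of four squares of elements
`(uᵢ + bᵢ√13) / 2` with `uᵢ ≡ bᵢ (mod 2)` have no integral solution. -/
lemma no_four_squares_coefficients {u₁ b₁ u₂ b₂ u₃ b₃ u₄ b₄ : ℤ}
    (h₁ : (2 : ℤ) ∣ u₁ - b₁) (h₂ : (2 : ℤ) ∣ u₂ - b₂) (h₃ : (2 : ℤ) ∣ u₃ - b₃)
    (h₄ : (2 : ℤ) ∣ u₄ - b₄)
    (hrat : u₁ ^ 2 + u₂ ^ 2 + u₃ ^ 2 + u₄ ^ 2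
      + 13 * (b₁ ^ 2 + b₂ ^ 2 + b₃ ^ 2 + b₄ ^ 2) = 48)
    (hirr : u₁ * b₁ + u₂ * b₂ + u₃ * b₃ + u₄ * b₄ = 4) : False := by
  have hb : b₁ ^ 2 + b₂ ^ 2 + b₃ ^ 2 + b₄ ^ 2 ≤ 3 := by
    have := sq_nonneg u₁
    have := sq_nonneg u₂
    have := sq_nonneg u₃
    have := sq_nonneg u₄
    omega
  have cases_coeff {u b : ℤ} (h : (2 : ℤ) ∣ u - b) (hb : b ^ 2 ≤ 3) :
      (b ^ 2 = 0 ∧ u * b = 0 ∧ u % 2 = 0) ∨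
        (b ^ 2 = 1 ∧ (u * b) % 2 = 1 ∧ (u * b) ^ 2 = u ^ 2) := by
    have hlo : -1 ≤ b := by nlinarith
    have hhi : b ≤ 1 := by nlinarith
    interval_cases b
    · exact Or.inr ⟨by norm_num, by omega, by ring⟩
    · exact Or.inl ⟨by norm_num, by ring, by omega⟩
    · exact Or.inr ⟨by norm_num, by omega, by ring⟩
  rcases cases_coeff h₁ (by nlinarith) with ⟨e₁, f₁, g₁⟩ | ⟨e₁, f₁, g₁⟩ <;>
  rcases cases_coeff h₂ (by nlinarith) with ⟨e₂, f₂, g₂⟩ | ⟨e₂, f₂, g₂⟩ <;>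
  rcases cases_coeff h₃ (by nlinarith) with ⟨e₃, f₃, g₃⟩ | ⟨e₃, f₃, g₃⟩ <;>
  rcases cases_coeff h₄ (by nlinarith) with ⟨e₄, f₄, g₄⟩ | ⟨e₄, f₄, g₄⟩ <;>
  first
  | omega
  | exact sum_sq_ne_twenty_two f₁ g₃ g₄ (q := u₂ * b₂) (by omega) (by omega)
  | exact sum_sq_ne_twenty_two f₁ g₂ g₄ (q := u₃ * b₃) (by omega) (by omega)
  | exact sum_sq_ne_twenty_two f₁ g₂ g₃ (q := u₄ * b₄) (by omega) (by omega)
  | exact sum_sq_ne_twenty_two f₂ g₁ g₄ (q := u₃ * b₃) (by omega) (by omega)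
  | exact sum_sq_ne_twenty_two f₂ g₁ g₃ (q := u₄ * b₄) (by omega) (by omega)
  | exact sum_sq_ne_twenty_two f₃ g₁ g₂ (q := u₄ * b₄) (by omega) (by omega)

/-- The minimal equation of `2 cos(2π/13)`. -/
lemma two_cos_two_pi_div_thirteen_equation {t : ℝ} (ht : t = 2 * Real.cos (2 * Real.pi / 13)) :
    t ^ 6 + t ^ 5 - 5 * t ^ 4 - 4 * t ^ 3 + 6 * t ^ 2 + 3 * t - 1 = 0 := by
  set θ := 2 * Real.pi / 13 with hθ
  have hpi := Real.pi_pos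
  have hne : t - 2 ≠ 0 := by
    have h := Real.cos_lt_cos_of_nonneg_of_le_pi (x := 0) (y := θ) le_rfl
      (by rw [hθ]; linarith) (by rw [hθ]; positivity)
    rw [Real.cos_zero] at h
    exact ne_of_lt (by linarith)
  have hcos : Real.cos θ = t / 2 := by linarith
  have h₃ : Real.cos (3 * θ) = (t ^ 3 - 3 * t) / 2 := by
    rw [Real.cos_three_mul, hcos]
    ring
  have h₆ : Real.cos (6 * θ) = ((t ^ 3 - 3 * t) ^ 2 - 2) / 2 := by
    rw [show 6 * θ = 2 * (3 * θ) by ring, Real.cos_two_mul, h₃]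
    ring
  have h₄ : Real.cos (4 * θ) = ((t ^ 2 - 2) ^ 2 - 2) / 2 := by
    rw [show 4 * θ = 2 * (2 * θ) by ring, Real.cos_two_mul, Real.cos_two_mul, hcos]
    ring
  have h₇ : Real.cos (6 * θ) + Real.cos θ = 2 * Real.cos (4 * θ) * Real.cos (3 * θ) := by
    have h₄₃ : Real.cos (6 * θ) = Real.cos (4 * θ + 3 * θ) := by
      rw [← Real.cos_two_pi_sub]
      congr 1
      rw [hθ]
      ring
    have h₁ : Real.cos θ = Real.cos (4 * θ - 3 * θ) := by
      congr 1
      ring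
    rw [h₄₃, h₁, Real.cos_add, Real.cos_sub]
    ring
  rw [h₆, h₄, h₃, hcos] at h₇
  refine (mul_eq_zero.mp ?_).resolve_left hne
  linear_combination -2 * h₇

/-- The quadratic Gauss sum modulo `13`, as a polynomial in `2 cos(2π/13)`. -/
lemma sqrt_thirteen_eq {t : ℝ} (ht : t = 2 * Real.cos (2 * Real.pi / 13)) :
    Real.sqrt 13 = 2 * t ^ 4 + 2 * t ^ 3 - 8 * t ^ 2 - 4 * t + 5 := by
  have hm := two_cos_two_pi_div_thirteen_equation ht
  have hlo : √3 < t := by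
    have h := Real.cos_lt_cos_of_nonneg_of_le_pi (x := 2 * Real.pi / 13) (y := Real.pi / 6)
      (by positivity) (by linarith [Real.pi_pos]) (by linarith [Real.pi_pos])
    rw [Real.cos_pi_div_six] at h
    linarith
  have hpos : 0 < t := lt_of_le_of_lt (Real.sqrt_nonneg 3) hlo
  have hsq : 3 < t ^ 2 := (Real.sqrt_lt' hpos).mp hlo
  have hcub : 0 < t * (t ^ 2 - 3) := mul_pos hpos (by linarith)
  refine (Real.sqrt_eq_iff_mul_self_eq_of_pos ?_).mpr ?_
  · nlinarith
  · linear_combination (4 * t ^ 2 + 4 * t - 12) * hm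

/-- Let `α = 12 + 2√13`. Then `α` is not a sum of four squares of elements
of `ℤ[(1+√13)/2]`, the ring of integers of `ℚ(√13)`, but `α` is a sum of four squares of
elements of `ℤ[ζ₁₃ + ζ₁₃⁻¹] = ℤ[2 cos(2π/13)]`, the ring of integers of the maximal totally
real subfield `ℚ(ζ₁₃ + ζ₁₃⁻¹)` of the 13th cyclotomic field. -/
theorem statement14 :
    (¬ ∃ w x y z : ℝ,
      w ∈ Algebra.adjoin ℤ {(1 + Real.sqrt 13) / 2} ∧
      x ∈ Algebra.adjoin ℤ {(1 + Real.sqrt 13) / 2} ∧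
      y ∈ Algebra.adjoin ℤ {(1 + Real.sqrt 13) / 2} ∧
      z ∈ Algebra.adjoin ℤ {(1 + Real.sqrt 13) / 2} ∧
      12 + 2 * Real.sqrt 13 = w ^ 2 + x ^ 2 + y ^ 2 + z ^ 2) ∧
    (∃ w x y z : ℝ,
      w ∈ Algebra.adjoin ℤ {2 * Real.cos (2 * Real.pi / 13)} ∧
      x ∈ Algebra.adjoin ℤ {2 * Real.cos (2 * Real.pi / 13)} ∧
      y ∈ Algebra.adjoin ℤ {2 * Real.cos (2 * Real.pi / 13)} ∧
      z ∈ Algebra.adjoin ℤ {2 * Real.cos (2 * Real.pi / 13)} ∧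
      12 + 2 * Real.sqrt 13 = w ^ 2 + x ^ 2 + y ^ 2 + z ^ 2) := by
  constructor
  · rintro ⟨w, x, y, z, hw, hx, hy, hz, h⟩
    obtain ⟨u₁, b₁, h₁, rfl⟩ := exists_int_of_mem_adjoin hw
    obtain ⟨u₂, b₂, h₂, rfl⟩ := exists_int_of_mem_adjoin hx
    obtain ⟨u₃, b₃, h₃, rfl⟩ := exists_int_of_mem_adjoin hy
    obtain ⟨u₄, b₄, h₄, rfl⟩ := exists_int_of_mem_adjoin hz
    have hs : Real.sqrt 13 ^ 2 = 13 := Real.sq_sqrt (by norm_num)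
    obtain ⟨hrat, hirr⟩ := int_add_mul_sqrt_thirteen_inj
      (a := u₁ ^ 2 + u₂ ^ 2 + u₃ ^ 2 + u₄ ^ 2 + 13 * (b₁ ^ 2 + b₂ ^ 2 + b₃ ^ 2 + b₄ ^ 2))
      (b := 2 * (u₁ * b₁ + u₂ * b₂ + u₃ * b₃ + u₄ * b₄)) (c := 48) (d := 8) (by
        push_cast
        linear_combination -4 * h - (b₁ ^ 2 + b₂ ^ 2 + b₃ ^ 2 + b₄ ^ 2 : ℝ) * hs)
    exact no_four_squares_coefficients h₁ h₂ h₃ h₄ hrat (by omega)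
  · obtain ⟨t, ht⟩ : ∃ t, t = 2 * Real.cos (2 * Real.pi / 13) := ⟨_, rfl⟩
    have hm := two_cos_two_pi_div_thirteen_equation ht
    rw [← ht, sqrt_thirteen_eq ht]
    have hmem (p : Polynomial ℤ) {x : ℝ} (hx : Polynomial.aeval t p = x) :
        x ∈ Algebra.adjoin ℤ {t} :=
      hx ▸ Polynomial.aeval_mem_adjoin_singleton ℤ t
    refine ⟨1, t ^ 2 + t - 2, -t ^ 5 - t ^ 4 + 6 * t ^ 3 + 4 * t ^ 2 - 8 * t - 2,
      -t ^ 5 - t ^ 4 + 4 * t ^ 3 + 3 * t ^ 2 - 3 * t - 1, one_mem _, ?_, ?_, ?_, ?_⟩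
    · exact hmem (.X ^ 2 + .X - 2) (by simp [map_ofNat])
    · exact hmem (-.X ^ 5 - .X ^ 4 + 6 * .X ^ 3 + 4 * .X ^ 2 - 8 * .X - 2) (by simp [map_ofNat])
    · exact hmem (-.X ^ 5 - .X ^ 4 + 4 * .X ^ 3 + 3 * .X ^ 2 - 3 * .X - 1) (by simp [map_ofNat])
    · linear_combination (-2 * t ^ 4 - 2 * t ^ 3 + 10 * t ^ 2 + 6 * t - 12) * hm
end
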